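/- arXiv:1803.06964 — 2 statements merged into one kernel-verified Lean document; each statement's English description precedes it below -/
import Mathlib

section
/- Fix κ ∈ (0,1) and γ ≥ 0 with γ < g_MLE(κ), i.e. κ < min_{t∈ℝ} E[(Z − tV)₊²]. Consider a sequence of logistic models with n observations and p = p(n) predictors, p/n → κ, rows X_i i.i.d. N(0, n⁻¹Iₚ), responses y_i ∈ {0,1} with P(y_i = 1 | X_i) = ρ'(X_i'β), and regression vectors β = β(n) satisfying lim_{n→∞} ‖β‖²/n = γ². Then the probability that the maximum-likelihood estimator exists (i.e. that the negative log-likelihood ℓ(b) = Σ_{i=1}^n {ρ(X_i'b) − y_i X_i'b} attains its minimum at a finite point) converges to 1 as n → ∞. -/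
open MeasureTheory ProbabilityTheory Filter
open scoped Topology NNReal ENNReal

noncomputable section

/-- `ρ(t) = log(1 + eᵗ)`. -/
def rho (t : ℝ) : ℝ := Real.log (1 + Real.exp t)

/-- The sigmoid `ρ'(t) = eᵗ/(1+eᵗ)`. -/
def rho' (t : ℝ) : ℝ := Real.exp t / (1 + Real.exp t)

/-- `ρ''(t) = ρ'(t)(1 - ρ'(t))`. -/
def rho'' (t : ℝ) : ℝ := rho' t * (1 - rho' t)

/-- The proximal operator `prox_{λρ}(z)`, characterized by `t + λρ'(t) = z`. -/
def prox (lam z : ℝ) : ℝ := Function.invFun (fun t : ℝ => t + lam * rho' t) z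

/-- Standard Gaussian measure on `ℝ`. -/
def gauss : Measure ℝ := gaussianReal 0 1

/-- Uniform measure on `[0,1]`. -/
def unif : Measure ℝ := volume.restrict (Set.Icc (0 : ℝ) 1)

/-- `g_MLE⁻¹(γ) = min_t E[(Z - tV)₊²]`, where `Z` is standard normal and `V` is an
independent variable with density `2ρ'(γ·)φ(·)`. -/
def gMLEinv (γ : ℝ) : ℝ :=
  ⨅ t : ℝ, ∫ z, (∫ v, (max (z - t * v) 0) ^ 2 * (2 * rho' (γ * v)) ∂gauss) ∂gauss

/-- Negative log-likelihood of the logistic model. -/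
def negLogLik {n p : ℕ} (X : Fin n → Fin p → ℝ) (y : Fin n → ℝ) (b : Fin p → ℝ) : ℝ :=
  ∑ i, (rho (∑ j, X i j * b j) - y i * ∑ j, X i j * b j)

/-- Logistic responses: `y_i = 1(U_i ≤ ρ'(X_i'β))`, so that `P(y_i = 1 | X_i) = ρ'(X_i'β)`. -/
def resp {n p : ℕ} (X : Fin n → Fin p → ℝ) (U : Fin n → ℝ) (β : Fin p → ℝ) : Fin n → ℝ :=
  fun i => if U i ≤ rho' (∑ j, X i j * β j) then 1 else 0

/-- Joint law of the design matrix (i.i.d. `N(0, n⁻¹ I_p)` rows) and of independent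
uniform variables used to generate logistic responses. -/
def designLaw (n p : ℕ) : Measure ((Fin n → Fin p → ℝ) × (Fin n → ℝ)) :=
  (Measure.pi fun _ : Fin n => Measure.pi fun _ : Fin p => gaussianReal 0 ((n : ℝ≥0))⁻¹).prod
    (Measure.pi fun _ : Fin n => unif)

/-- Iterated expectation over two independent standard Gaussians. -/
def E2 (f : ℝ → ℝ → ℝ) : ℝ := ∫ z1, (∫ z2, f z1 z2 ∂gauss) ∂gauss

/-- The system (S) of three nonlinear equations in `(α, σ, λ)`, with parameters `(κ, γ)`.
Here `(Q₁, Q₂) = (γ Z₁, -αγ Z₁ + √κ σ Z₂)` is the centered bivariate Gaussian with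
`Var(Q₁) = γ²`, `Cov(Q₁, Q₂) = -αγ²`, `Var(Q₂) = α²γ² + κσ²`. -/
def solvesS (κ γ α σ lam : ℝ) : Prop :=
  σ ^ 2 = (1 / κ ^ 2) *
      E2 (fun z1 z2 => 2 * rho' (γ * z1) *
        (lam * rho' (prox lam (-(α * γ) * z1 + Real.sqrt κ * σ * z2))) ^ 2) ∧
  0 = E2 (fun z1 z2 => rho' (γ * z1) * (γ * z1) *
        (lam * rho' (prox lam (-(α * γ) * z1 + Real.sqrt κ * σ * z2)))) ∧
  1 - κ = E2 (fun z1 z2 => 2 * rho' (γ * z1) /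
        (1 + lam * rho'' (prox lam (-(α * γ) * z1 + Real.sqrt κ * σ * z2))))

instance isProbabilityMeasure_gauss : IsProbabilityMeasure gauss := by
  unfold gauss; infer_instance

/-- The standard Gaussian measure on `ι → ℝ`. -/
def gaussPi (ι : Type*) [Fintype ι] : Measure (ι → ℝ) := Measure.pi fun _ => gauss

instance isProbabilityMeasure_gaussPi (ι : Type*) [Fintype ι] :
    IsProbabilityMeasure (gaussPi ι) := by
  unfold gaussPi; infer_instance

lemma integrable_pow_gauss (k : ℕ) : Integrable (fun x : ℝ => x ^ k) gauss := by
  have h := (memLp_id_gaussianReal (μ := 0) (v := 1) (k : ℝ≥0)).integrable_norm_pow'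
  refine (integrable_norm_iff (by fun_prop)).1 (h.congr (ae_of_all _ fun x => ?_))
  simp

lemma integrable_id_gauss : Integrable (fun x : ℝ => x) gauss := by
  simpa using integrable_pow_gauss 1

lemma hasDerivAt_gaussianPDFReal_zero_one (x : ℝ) :
    HasDerivAt (gaussianPDFReal 0 1) (-(x * gaussianPDFReal 0 1 x)) x := by
  have h1 : HasDerivAt (fun x : ℝ => -(x - 0) ^ 2 / (2 * ((1 : ℝ≥0) : ℝ))) (-x) x := by
    refine ((((hasDerivAt_id x).sub_const 0).pow 2).neg.div_const
      (2 * ((1 : ℝ≥0) : ℝ))).congr_deriv ?_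
    simp
    ring
  have h2 := h1.exp.const_mul ((√(2 * Real.pi * ((1 : ℝ≥0) : ℝ)))⁻¹)
  rw [gaussianPDFReal_def]
  exact h2.congr_deriv (by ring)

lemma integrable_gauss_iff {f : ℝ → ℝ} :
    Integrable f gauss ↔ Integrable (fun x => gaussianPDFReal 0 1 x * f x) := by
  unfold gauss
  rw [gaussianReal_of_var_ne_zero 0 one_ne_zero, integrable_withDensity_iff_integrable_smul₀'
    (measurable_gaussianPDF 0 1).aemeasurable (ae_of_all _ fun x => gaussianPDF_lt_top)]
  simp [toReal_gaussianPDF]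

/-- Gaussian integration by parts in dimension one. -/
lemma integral_id_mul_gauss {f f' : ℝ → ℝ} {B : ℝ} (hf : ∀ x, HasDerivAt f (f' x) x)
    (hf' : Measurable f') (hB : ∀ x, |f x| ≤ B) (hB' : ∀ x, |f' x| ≤ B) :
    ∫ x, x * f x ∂gauss = ∫ x, f' x ∂gauss := by
  have hfm : Measurable f :=
    (continuous_iff_continuousAt.2 fun x => (hf x).continuousAt).measurable
  have i1 : Integrable (fun x => x * f x) gauss :=
    integrable_id_gauss.mul_bdd (c := B) (by fun_prop) (ae_of_all _ hB)
  have i2 : Integrable f' gauss := .of_bound (by fun_prop) B (ae_of_all _ hB')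
  have i3 : Integrable f gauss := .of_bound (by fun_prop) B (ae_of_all _ hB)
  rw [integrable_gauss_iff] at i1 i2 i3
  have key := integral_mul_deriv_eq_deriv_mul_of_integrable (u := f) (u' := f')
    (v := gaussianPDFReal 0 1) (v' := fun x => -(x * gaussianPDFReal 0 1 x))
    (fun x _ => hf x) (fun x _ => hasDerivAt_gaussianPDFReal_zero_one x)
    (by convert i1.neg using 1; ext x; simp; ring)
    (by convert i2 using 1; ext x; simp; ring)
    (by convert i3 using 1; ext x; simp; ring)
  unfold gauss
  rw [integral_gaussianReal_eq_integral_smul one_ne_zero,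
    integral_gaussianReal_eq_integral_smul one_ne_zero]
  simp only [smul_eq_mul]
  rw [← neg_inj, ← integral_neg]
  convert key using 1
  · congr 1; ext x; ring
  · simp only [mul_comm]

/-- Resampling one coordinate preserves the standard Gaussian measure. -/
lemma measurePreserving_update_gauss {ι : Type*} [Fintype ι] [DecidableEq ι] (a : ι) :
    MeasurePreserving (fun z : ℝ × (ι → ℝ) => Function.update z.2 a z.1)
      (gauss.prod (gaussPi ι)) (gaussPi ι) := by
  have hm : Measurable (fun z : ℝ × (ι → ℝ) => Function.update z.2 a z.1) := by
    refine measurable_pi_lambda _ fun i => ?_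
    by_cases h : i = a
    · subst h; simpa using measurable_fst
    · simp only [Function.update_of_ne h]; fun_prop
  refine ⟨hm, Eq.symm ?_⟩
  refine Measure.pi_eq fun s hs => ?_
  rw [Measure.map_apply hm (MeasurableSet.univ_pi hs)]
  have : (fun z : ℝ × (ι → ℝ) => Function.update z.2 a z.1) ⁻¹' Set.univ.pi s
      = s a ×ˢ Set.univ.pi (Function.update s a Set.univ) := by
    ext ⟨t, x⟩
    simp only [Set.mem_preimage, Set.mem_pi, Set.mem_univ, true_imp_iff, Set.mem_prod]
    constructor
    · intro h
      refine ⟨by simpa using h a, fun i => ?_⟩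
      by_cases hi : i = a
      · subst hi; simp
      · simpa [hi] using h i
    · rintro ⟨h1, h2⟩ i
      by_cases hi : i = a
      · subst hi; simpa using h1
      · simpa [hi] using h2 i
  rw [this, Measure.prod_prod, gaussPi, Measure.pi_pi,
    ← Finset.mul_prod_erase _ _ (Finset.mem_univ a),
    ← Finset.mul_prod_erase Finset.univ (fun i => gauss (s i)) (Finset.mem_univ a)]
  simp only [Function.update_self, measure_univ, one_mul]
  congr 1
  refine Finset.prod_congr rfl fun i hi => ?_
  rw [Function.update_of_ne (Finset.ne_of_mem_erase hi)]

lemma integrable_apply_gaussPi {ι : Type*} [Fintype ι] (a : ι) :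
    Integrable (fun x : ι → ℝ => x a) (gaussPi ι) :=
  (measurePreserving_eval (fun _ : ι => gauss) a).integrable_comp_of_integrable
    integrable_id_gauss

/-- Gaussian integration by parts in one coordinate. -/
lemma integral_apply_mul_gaussPi {ι : Type*} [Fintype ι] [DecidableEq ι] (a : ι)
    {f f' : (ι → ℝ) → ℝ} {B : ℝ}
    (hf : ∀ x t, HasDerivAt (fun t => f (Function.update x a t)) (f' (Function.update x a t)) t)
    (hfm : Measurable f) (hfm' : Measurable f') (hB : ∀ x, |f x| ≤ B) (hB' : ∀ x, |f' x| ≤ B) :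
    ∫ x, x a * f x ∂gaussPi ι = ∫ x, f' x ∂gaussPi ι := by
  have hmp := measurePreserving_update_gauss a
  have hm := hmp.measurable
  have i1 : Integrable (fun x : ι → ℝ => x a * f x) (gaussPi ι) :=
    (integrable_apply_gaussPi a).mul_bdd (c := B) (by fun_prop) (ae_of_all _ hB)
  have i2 : Integrable f' (gaussPi ι) := .of_bound (by fun_prop) B (ae_of_all _ hB')
  have e1 := integral_map (μ := gauss.prod (gaussPi ι)) (f := fun x : ι → ℝ => x a * f x)
    hm.aemeasurable (by rw [hmp.map_eq]; exact i1.aestronglyMeasurable)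
  have e2 := integral_map (μ := gauss.prod (gaussPi ι)) (f := f')
    hm.aemeasurable (by rw [hmp.map_eq]; exact i2.aestronglyMeasurable)
  rw [hmp.map_eq] at e1 e2
  have j1 := hmp.integrable_comp_of_integrable i1
  have j2 := hmp.integrable_comp_of_integrable i2
  simp only [Function.comp_def] at j1 j2
  rw [e1, e2, integral_prod_symm _ j1, integral_prod_symm _ j2]
  congr 1
  ext x
  simp only [Function.update_self]
  have hx : Measurable fun t : ℝ => Function.update x a t := measurable_update x
  exact integral_id_mul_gauss (hf x) (hfm'.comp hx) (fun _ => hB _) (fun _ => hB' _)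

/-- The decreasing logistic approximation of the indicator of `(-∞, c)` at scale `1 / lam`. -/
def softStep (lam c x : ℝ) : ℝ := (1 + Real.exp (lam * (x - c)))⁻¹

lemma softStep_mem_Icc (lam c x : ℝ) : softStep lam c x ∈ Set.Icc (0 : ℝ) 1 := by
  have := Real.exp_pos (lam * (x - c))
  refine ⟨by unfold softStep; positivity, ?_⟩
  exact inv_le_one_of_one_le₀ (by linarith)

lemma hasDerivAt_softStep (lam c x : ℝ) :
    HasDerivAt (softStep lam c) (-lam * (softStep lam c x * (1 - softStep lam c x))) x := by
  have hpos := Real.exp_pos (lam * (x - c))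
  have h : HasDerivAt (fun x => 1 + Real.exp (lam * (x - c))) (Real.exp (lam * (x - c)) * lam) x :=
    ((((hasDerivAt_id x).sub_const c).const_mul lam).exp.const_add 1).congr_deriv (by simp)
  refine (h.inv (by positivity)).congr_deriv ?_
  unfold softStep
  field_simp
  ring

lemma continuous_softStep (lam c : ℝ) : Continuous (softStep lam c) :=
  continuous_iff_continuousAt.2 fun x => (hasDerivAt_softStep lam c x).continuousAt

section SoftPoly

variable {M : Type*}

/-- A polynomial in the soft steps of the coordinates. -/
def softPoly (lam c : ℝ) (P : MvPolynomial M ℝ) (x : M → ℝ) : ℝ :=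
  MvPolynomial.eval (fun m => softStep lam c (x m)) P

/-- The derivation of polynomials that corresponds to the partial derivative of `softPoly`. -/
def softDeriv (lam : ℝ) (m : M) : Derivation ℝ (MvPolynomial M ℝ) (MvPolynomial M ℝ) :=
  (MvPolynomial.C (-lam) * (MvPolynomial.X m * (1 - MvPolynomial.X m))) • MvPolynomial.pderiv m

lemma continuous_softPoly (lam c : ℝ) (P : MvPolynomial M ℝ) : Continuous (softPoly lam c P) :=
  (MvPolynomial.continuous_eval P).comp
    (continuous_pi fun m => (continuous_softStep lam c).comp (continuous_apply m))

lemma exists_bound_softPoly (lam c : ℝ) (P : MvPolynomial M ℝ) :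
    ∃ B, ∀ x, |softPoly lam c P x| ≤ B := by
  have hc : IsCompact (Set.univ.pi fun _ : M => Set.Icc (0 : ℝ) 1) :=
    isCompact_univ_pi fun _ => isCompact_Icc
  obtain ⟨B, hB⟩ := hc.exists_bound_of_continuousOn (MvPolynomial.continuous_eval P).continuousOn
  exact ⟨B, fun x => hB _ fun m _ => softStep_mem_Icc lam c (x m)⟩

variable [Fintype M] [DecidableEq M]

lemma hasDerivAt_eval_mvPolynomial (P : MvPolynomial M ℝ) {y : ℝ → M → ℝ} {y' : M → ℝ} {t : ℝ}
    (hy : ∀ m, HasDerivAt (fun s => y s m) (y' m) t) :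
    HasDerivAt (fun s => MvPolynomial.eval (y s) P)
      (∑ m, MvPolynomial.eval (y t) (MvPolynomial.pderiv m P) * y' m) t := by
  induction P using MvPolynomial.induction_on with
  | C a => simpa using hasDerivAt_const t a
  | add P Q hP hQ =>
    simp only [map_add, add_mul, Finset.sum_add_distrib]
    exact hP.add hQ
  | mul_X P n hP =>
    simp only [map_mul, MvPolynomial.eval_X]
    refine (hP.mul (hy n)).congr_deriv ?_
    simp only [MvPolynomial.pderiv_mul, map_add, map_mul, MvPolynomial.eval_X,
      MvPolynomial.pderiv_X, add_mul, Finset.sum_add_distrib, Finset.sum_mul]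
    congr 1
    · exact Finset.sum_congr rfl fun m _ => by ring
    · rw [Finset.sum_eq_single n]
      · simp
      · intro m _ hm; simp [hm.symm]
      · simp

lemma hasDerivAt_softPoly (lam c : ℝ) (P : MvPolynomial M ℝ) {y : ℝ → M → ℝ} {y' : M → ℝ} {t : ℝ}
    (hy : ∀ m, HasDerivAt (fun s => y s m) (y' m) t) :
    HasDerivAt (fun s => softPoly lam c P (y s))
      (∑ m, softPoly lam c (softDeriv lam m P) (y t) * y' m) t := by
  have h : ∀ m, HasDerivAt (fun s => softStep lam c (y s m))
      (-lam * (softStep lam c (y t m) * (1 - softStep lam c (y t m))) * y' m) t :=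
    fun m => HasDerivAt.comp (h := fun s => y s m) t (hasDerivAt_softStep lam c (y t m)) (hy m)
  refine (hasDerivAt_eval_mvPolynomial P (y := fun s m => softStep lam c (y s m)) h).congr_deriv ?_
  refine Finset.sum_congr rfl fun m _ => ?_
  simp only [softPoly, softDeriv, Derivation.smul_apply, smul_eq_mul, map_mul, map_sub,
    MvPolynomial.eval_X, MvPolynomial.eval_C, map_one]
  ring

variable {ι : Type*} [Fintype ι] [DecidableEq ι]

lemma integral_apply_mul_softPoly (lam c : ℝ) (P : MvPolynomial M ℝ) (C : M → ι → ℝ) (a : ι) :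
    ∫ x, x a * softPoly lam c P (fun m => ∑ i, C m i * x i) ∂gaussPi ι =
      ∑ m, C m a *
        ∫ x, softPoly lam c (softDeriv lam m P) (fun m => ∑ i, C m i * x i) ∂gaussPi ι := by
  have hlin : Continuous fun x : ι → ℝ => fun m => ∑ i, C m i * x i := by fun_prop
  have hcont : ∀ Q : MvPolynomial M ℝ,
      Continuous fun x : ι → ℝ => softPoly lam c Q (fun m => ∑ i, C m i * x i) :=
    fun Q => (continuous_softPoly lam c Q).comp hlin
  choose B hB using exists_bound_softPoly (M := M) lam c
  have hB0 : ∀ Q, 0 ≤ B Q := fun Q => (abs_nonneg _).trans (hB Q 0)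
  have hInt : ∀ Q : MvPolynomial M ℝ,
      Integrable (fun x : ι → ℝ => softPoly lam c Q (fun m => ∑ i, C m i * x i)) (gaussPi ι) :=
    fun Q => .of_bound (hcont Q).aestronglyMeasurable (B Q) (ae_of_all _ fun x => hB Q _)
  rw [integral_apply_mul_gaussPi a (B := B P + ∑ m, B (softDeriv lam m P) * |C m a|)
    (f' := fun x => ∑ m, softPoly lam c (softDeriv lam m P) (fun m => ∑ i, C m i * x i) * C m a)]
  · rw [integral_finsetSum _ fun m _ => (hInt _).mul_const _]
    simp only [integral_mul_const]
    exact Finset.sum_congr rfl fun m _ => mul_comm _ _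
  · intro x t
    refine hasDerivAt_softPoly lam c P (y := fun t m => ∑ i, C m i * Function.update x a t i)
      fun m => ?_
    have : ∀ i ∈ Finset.univ, HasDerivAt (fun t => C m i * Function.update x a t i)
        (C m i * (Pi.single a 1 : ι → ℝ) i) t := fun i _ =>
      ((hasDerivAt_pi.1 (hasDerivAt_update x a t)) i).const_mul _
    refine (HasDerivAt.fun_sum this).congr_deriv ?_
    simp [Pi.single_apply]
  · exact (hcont P).measurable
  · exact (continuous_finsetSum _ fun m _ => (hcont _).mul continuous_const).measurable
  · intro x
    refine (hB P _).trans (le_add_of_nonneg_right ?_)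
    exact Finset.sum_nonneg fun m _ => mul_nonneg (hB0 _) (abs_nonneg _)
  · intro x
    refine (Finset.abs_sum_le_sum_abs _ _).trans (le_trans ?_ (le_add_of_nonneg_left (hB0 P)))
    refine Finset.sum_le_sum fun m _ => ?_
    rw [abs_mul]
    exact mul_le_mul_of_nonneg_right (hB _ _) (abs_nonneg _)

end SoftPoly

section Interpolation

variable {M ι ι' : Type*}

lemma measurePreserving_inl_gaussPi (ι ι' : Type*) [Fintype ι] [Fintype ι'] :
    MeasurePreserving (fun x : ι ⊕ ι' → ℝ => fun i => x (Sum.inl i)) (gaussPi (ι ⊕ ι'))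
      (gaussPi ι) :=
  (measurePreserving_fst (μ := gaussPi ι) (ν := gaussPi ι')).comp
    (measurePreserving_sumPiEquivProdPi fun _ : ι ⊕ ι' => gauss)

lemma measurePreserving_inr_gaussPi (ι ι' : Type*) [Fintype ι] [Fintype ι'] :
    MeasurePreserving (fun x : ι ⊕ ι' → ℝ => fun i => x (Sum.inr i)) (gaussPi (ι ⊕ ι'))
      (gaussPi ι') :=
  (measurePreserving_snd (μ := gaussPi ι) (ν := gaussPi ι')).comp
    (measurePreserving_sumPiEquivProdPi fun _ : ι ⊕ ι' => gauss)

/-- The coefficients of the trigonometric interpolation between two Gaussian vectors. -/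
def interpCoeff (A : M → ι → ℝ) (B : M → ι' → ℝ) (s c : ℝ) (m : M) : ι ⊕ ι' → ℝ :=
  Sum.elim (fun i => s * A m i) (fun i => c * B m i)

lemma continuous_softPoly_linear [Fintype ι] (lam c : ℝ) (P : MvPolynomial M ℝ) (C : M → ι → ℝ) :
    Continuous fun x : ι → ℝ => softPoly lam c P (fun m => ∑ i, C m i * x i) :=
  (continuous_softPoly lam c P).comp (g := softPoly lam c P)
    (f := fun x : ι → ℝ => fun m => ∑ i, C m i * x i) (by fun_prop)

lemma hasDerivAt_interpCoeff (A : M → ι → ℝ) (B : M → ι' → ℝ) (m : M) (i : ι ⊕ ι') (t : ℝ) :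
    HasDerivAt (fun t => interpCoeff A B (Real.sin t) (Real.cos t) m i)
      (interpCoeff A B (Real.cos t) (-Real.sin t) m i) t := by
  rcases i with i | i
  · simpa only [interpCoeff, Sum.elim_inl] using (Real.hasDerivAt_sin t).mul_const (A m i)
  · simpa only [interpCoeff, Sum.elim_inr] using (Real.hasDerivAt_cos t).mul_const (B m i)

variable [Fintype M] [DecidableEq M] [Fintype ι] [Fintype ι']

lemma hasDerivAt_integral_softPoly_interp (lam c : ℝ) (P : MvPolynomial M ℝ)
    (A : M → ι → ℝ) (B : M → ι' → ℝ) (θ : ℝ) :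
    HasDerivAt (fun θ => ∫ x, softPoly lam c P
        (fun m => ∑ i, interpCoeff A B (Real.sin θ) (Real.cos θ) m i * x i) ∂gaussPi (ι ⊕ ι'))
      (∫ x, ∑ m, softPoly lam c (softDeriv lam m P)
        (fun m => ∑ i, interpCoeff A B (Real.sin θ) (Real.cos θ) m i * x i) *
        (∑ i, interpCoeff A B (Real.cos θ) (-Real.sin θ) m i * x i) ∂gaussPi (ι ⊕ ι')) θ := by
  choose b hb using exists_bound_softPoly (M := M) lam c
  have hb0 : ∀ Q, 0 ≤ b Q := fun Q => (abs_nonneg _).trans (hb Q 0)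
  have hcont : ∀ (Q : MvPolynomial M ℝ) (θ : ℝ), Continuous fun x : ι ⊕ ι' → ℝ =>
      softPoly lam c Q
        (fun m => ∑ i, interpCoeff A B (Real.sin θ) (Real.cos θ) m i * x i) := fun Q θ =>
    continuous_softPoly_linear lam c Q _
  have hcoef : ∀ (m : M) (i : ι ⊕ ι') (t : ℝ),
      |interpCoeff A B (Real.cos t) (-Real.sin t) m i| ≤ |interpCoeff A B 1 1 m i| := by
    rintro m (i | i) t
    · simpa [interpCoeff, abs_mul] using
        mul_le_mul_of_nonneg_right (Real.abs_cos_le_one t) (abs_nonneg (A m i))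
    · simpa [interpCoeff, abs_mul] using
        mul_le_mul_of_nonneg_right (Real.abs_sin_le_one t) (abs_nonneg (B m i))
  have hF : ∀ t : ℝ, AEStronglyMeasurable (fun x : ι ⊕ ι' → ℝ => softPoly lam c P
      (fun m => ∑ i, interpCoeff A B (Real.sin t) (Real.cos t) m i * x i)) (gaussPi (ι ⊕ ι')) :=
    fun t => (hcont P t).aestronglyMeasurable
  have hF' : AEStronglyMeasurable (fun x : ι ⊕ ι' → ℝ => ∑ m, softPoly lam c (softDeriv lam m P)
      (fun m => ∑ i, interpCoeff A B (Real.sin θ) (Real.cos θ) m i * x i) *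
      (∑ i, interpCoeff A B (Real.cos θ) (-Real.sin θ) m i * x i)) (gaussPi (ι ⊕ ι')) :=
    (continuous_finsetSum _ fun m _ => (hcont _ θ).mul (by fun_prop)).aestronglyMeasurable
  have hbound : ∀ (x : ι ⊕ ι' → ℝ) (t : ℝ), ‖∑ m, softPoly lam c (softDeriv lam m P)
      (fun m => ∑ i, interpCoeff A B (Real.sin t) (Real.cos t) m i * x i) *
      (∑ i, interpCoeff A B (Real.cos t) (-Real.sin t) m i * x i)‖ ≤
      ∑ m, b (softDeriv lam m P) * ∑ i, |interpCoeff A B 1 1 m i| * |x i| := fun x t => by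
    refine (Finset.abs_sum_le_sum_abs _ _).trans (Finset.sum_le_sum fun m _ => ?_)
    rw [abs_mul]
    refine mul_le_mul (hb _ _) ?_ (abs_nonneg _) (hb0 _)
    refine (Finset.abs_sum_le_sum_abs _ _).trans (Finset.sum_le_sum fun i _ => ?_)
    rw [abs_mul]
    exact mul_le_mul_of_nonneg_right (hcoef m i t) (abs_nonneg _)
  have hInt : Integrable (fun x : ι ⊕ ι' → ℝ => ∑ m, b (softDeriv lam m P) *
      ∑ i, |interpCoeff A B 1 1 m i| * |x i|) (gaussPi (ι ⊕ ι')) := by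
    refine integrable_finsetSum _ fun m _ => Integrable.const_mul ?_ _
    exact integrable_finsetSum _ fun i _ => (integrable_apply_gaussPi i).abs.const_mul _
  have hder : ∀ (x : ι ⊕ ι' → ℝ) (t : ℝ), HasDerivAt (fun t => softPoly lam c P
      (fun m => ∑ i, interpCoeff A B (Real.sin t) (Real.cos t) m i * x i))
      (∑ m, softPoly lam c (softDeriv lam m P)
      (fun m => ∑ i, interpCoeff A B (Real.sin t) (Real.cos t) m i * x i) *
      (∑ i, interpCoeff A B (Real.cos t) (-Real.sin t) m i * x i)) t := fun x t =>
    hasDerivAt_softPoly lam c P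
      (y := fun t m => ∑ i, interpCoeff A B (Real.sin t) (Real.cos t) m i * x i) fun m =>
        HasDerivAt.fun_sum fun i _ => (hasDerivAt_interpCoeff A B m i t).mul_const (x i)
  have key := hasDerivAt_integral_of_dominated_loc_of_deriv_le (𝕜 := ℝ) (x₀ := θ) univ_mem
    (.of_forall hF) (.of_bound (hF θ) (b P) (ae_of_all _ fun x => hb P _)) hF'
    (ae_of_all _ fun x t _ => hbound x t) hInt (ae_of_all _ fun x t _ => hder x t)
  exact key.2

/-- Kahane's comparison of two Gaussian vectors. -/
theorem integral_softPoly_le_of_cov [DecidableEq ι] [DecidableEq ι'] (lam c : ℝ)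
    (P : MvPolynomial M ℝ)
    (A : M → ι → ℝ) (B : M → ι' → ℝ)
    (h : ∀ m m' x, 0 ≤ (∑ i, A m i * A m' i - ∑ i, B m i * B m' i) *
      softPoly lam c (softDeriv lam m' (softDeriv lam m P)) x) :
    ∫ x, softPoly lam c P (fun m => ∑ i, B m i * x i) ∂gaussPi ι' ≤
      ∫ x, softPoly lam c P (fun m => ∑ i, A m i * x i) ∂gaussPi ι := by
  set Φ : ℝ → ℝ := fun θ => ∫ x, softPoly lam c P
        (fun m => ∑ i, interpCoeff A B (Real.sin θ) (Real.cos θ) m i * x i) ∂gaussPi (ι ⊕ ι')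
    with hΦ
  have hder := hasDerivAt_integral_softPoly_interp lam c P A B
  have hmono : MonotoneOn Φ (Set.Icc 0 (Real.pi / 2)) := by
    refine monotoneOn_of_deriv_nonneg (convex_Icc _ _)
      (fun θ _ => (hder θ).continuousAt.continuousWithinAt)
      (fun θ _ => (hder θ).differentiableAt.differentiableWithinAt) fun θ hθ => ?_
    rw [interior_Icc] at hθ
    rw [(hder θ).deriv]
    choose b hb using exists_bound_softPoly (M := M) lam c
    have hcont : ∀ (Q : MvPolynomial M ℝ), Continuous fun x : ι ⊕ ι' → ℝ => softPoly lam c Q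
        (fun m => ∑ i, interpCoeff A B (Real.sin θ) (Real.cos θ) m i * x i) := fun Q =>
      continuous_softPoly_linear lam c Q _
    have hInt : ∀ (Q : MvPolynomial M ℝ) (i : ι ⊕ ι'), Integrable (fun x : ι ⊕ ι' → ℝ => x i *
        softPoly lam c Q (fun m => ∑ i, interpCoeff A B (Real.sin θ) (Real.cos θ) m i * x i))
        (gaussPi (ι ⊕ ι')) := fun Q i =>
      (integrable_apply_gaussPi i).mul_bdd (c := b Q) (hcont Q).aestronglyMeasurable
        (ae_of_all _ fun x => hb Q _)
    have e1 : ∀ x : ι ⊕ ι' → ℝ, ∑ m, softPoly lam c (softDeriv lam m P)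
        (fun m => ∑ i, interpCoeff A B (Real.sin θ) (Real.cos θ) m i * x i) *
        (∑ i, interpCoeff A B (Real.cos θ) (-Real.sin θ) m i * x i) =
        ∑ m, ∑ i, interpCoeff A B (Real.cos θ) (-Real.sin θ) m i *
          (x i * softPoly lam c (softDeriv lam m P)
        (fun m => ∑ i, interpCoeff A B (Real.sin θ) (Real.cos θ) m i * x i)) := fun x => by
      refine Finset.sum_congr rfl fun m _ => ?_
      rw [Finset.mul_sum]
      exact Finset.sum_congr rfl fun i _ => by ring
    simp only [e1]
    rw [integral_finsetSum _ fun m _ => integrable_finsetSum _ fun i _ => (hInt _ i).const_mul _]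
    refine le_of_le_of_eq (b := ∑ m, ∑ m', Real.sin θ * Real.cos θ *
      ∫ x, (∑ i, A m i * A m' i - ∑ i, B m i * B m' i) *
        softPoly lam c (softDeriv lam m' (softDeriv lam m P))
        (fun m => ∑ i, interpCoeff A B (Real.sin θ) (Real.cos θ) m i * x i)
          ∂gaussPi (ι ⊕ ι')) ?_ ?_
    · have hs := Real.sin_nonneg_of_nonneg_of_le_pi hθ.1.le (by linarith [hθ.2, Real.pi_pos])
      have hc := Real.cos_nonneg_of_neg_pi_div_two_le_of_le
        (by linarith [hθ.1, Real.pi_pos]) hθ.2.le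
      exact Finset.sum_nonneg fun m _ => Finset.sum_nonneg fun m' _ =>
        mul_nonneg (mul_nonneg hs hc) (integral_nonneg fun x => h m m' _)
    · refine Finset.sum_congr rfl fun m _ => ?_
      rw [integral_finsetSum _ fun i _ => (hInt _ i).const_mul _]
      simp only [integral_const_mul, integral_apply_mul_softPoly, Finset.mul_sum]
      rw [Finset.sum_comm]
      refine Finset.sum_congr rfl fun m' _ => ?_
      simp only [← mul_assoc, ← Finset.sum_mul]
      congr 1
      rw [Fintype.sum_sum_type]
      simp only [interpCoeff, Sum.elim_inl, Sum.elim_inr, mul_sub, Finset.mul_sum]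
      rw [sub_eq_add_neg, ← Finset.sum_neg_distrib]
      congr 1 <;> exact Finset.sum_congr rfl fun i _ => by ring
  have h0 : Φ 0 = ∫ x, softPoly lam c P (fun m => ∑ i, B m i * x i) ∂gaussPi ι' := by
    rw [← (measurePreserving_inr_gaussPi ι ι').map_eq, integral_map
      (measurePreserving_inr_gaussPi ι ι').measurable.aemeasurable
      (continuous_softPoly_linear lam c P _).aestronglyMeasurable]
    simp [hΦ, interpCoeff, Fintype.sum_sum_type]
  have h1 : Φ (Real.pi / 2) =
      ∫ x, softPoly lam c P (fun m => ∑ i, A m i * x i) ∂gaussPi ι := by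
    rw [← (measurePreserving_inl_gaussPi ι ι').map_eq, integral_map
      (measurePreserving_inl_gaussPi ι ι').measurable.aemeasurable
      (continuous_softPoly_linear lam c P _).aestronglyMeasurable]
    simp [hΦ, interpCoeff, Fintype.sum_sum_type]
  rw [← h0, ← h1]
  have hpi := Real.pi_pos
  exact hmono (by constructor <;> linarith) (by constructor <;> linarith) (by linarith)

end Interpolation

section Gordon

variable {K J : Type*} [Fintype K] [Fintype J]

/-- The polynomial `∏ k, (1 - ∏ j, X (k, j))`, a smooth version of `∀ k, ∃ j`. -/
def minMaxPoly (K J : Type*) [Fintype K] [Fintype J] : MvPolynomial (K × J) ℝ :=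
  ∏ k, (1 - ∏ j, MvPolynomial.X (k, j))

lemma softPoly_minMaxPoly (lam c : ℝ) (x : K × J → ℝ) :
    softPoly lam c (minMaxPoly K J) x = ∏ k, (1 - ∏ j, softStep lam c (x (k, j))) := by
  simp [softPoly, minMaxPoly, map_prod]

lemma softDeriv_X_of_ne {M : Type*} {lam : ℝ} {m n : M} (h : n ≠ m) :
    softDeriv lam m (MvPolynomial.X n) = 0 := by
  simp [softDeriv, Derivation.smul_apply, MvPolynomial.pderiv_X_of_ne h]

lemma softDeriv_X_self {M : Type*} (lam : ℝ) (m : M) :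
    softDeriv lam m (MvPolynomial.X m) =
      MvPolynomial.C (-lam) * (MvPolynomial.X m * (1 - MvPolynomial.X m)) := by
  simp [softDeriv, Derivation.smul_apply]

lemma derivation_prod_eq_zero {R A ι : Type*} [CommRing R] [CommRing A] [Algebra R A]
    (D : Derivation R A A) (s : Finset ι) (f : ι → A) (h : ∀ i ∈ s, D (f i) = 0) :
    D (∏ i ∈ s, f i) = 0 := by
  classical
  induction s using Finset.induction_on with
  | empty => simp
  | insert a s ha ih =>
    rw [Finset.prod_insert ha, Derivation.leibniz, h a (by simp),
      ih fun i hi => h i (by simp [hi])]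
    simp

lemma softPoly_softDeriv_softDeriv_minMaxPoly_nonneg {lam : ℝ} (c : ℝ)
    {m m' : K × J} (h : m.1 ≠ m'.1) (x : K × J → ℝ) :
    0 ≤ softPoly lam c (softDeriv lam m' (softDeriv lam m (minMaxPoly K J))) x := by
  classical
  set R : K → MvPolynomial (K × J) ℝ := fun k => 1 - ∏ j, MvPolynomial.X (k, j) with hR
  have hzero : ∀ (n : K × J) (k : K), n.1 ≠ k → softDeriv lam n (R k) = 0 := fun n k hn => by
    rw [hR, map_sub, Derivation.map_one_eq_zero, derivation_prod_eq_zero, sub_zero]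
    exact fun j _ => softDeriv_X_of_ne fun hj => hn (by rw [← hj])
  have hself : ∀ n : K × J, softDeriv lam n (R n.1) = MvPolynomial.C lam *
      (MvPolynomial.X n * (1 - MvPolynomial.X n)) *
        ∏ j ∈ Finset.univ.erase n.2, MvPolynomial.X (n.1, j) := fun n => by
    rw [hR, map_sub, Derivation.map_one_eq_zero, ← Finset.mul_prod_erase _ _ (Finset.mem_univ n.2),
      Derivation.leibniz, derivation_prod_eq_zero]
    · simp only [softDeriv_X_self, Prod.mk.eta, smul_eq_mul, map_neg]
      ring
    · exact fun j hj => softDeriv_X_of_ne fun h' =>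
        (Finset.ne_of_mem_erase hj) (by rw [← h'])
  have hzero' : softDeriv lam m' (softDeriv lam m (R m.1)) = 0 := by
    have hX : ∀ j, softDeriv lam m' (MvPolynomial.X (m.1, j)) = 0 := fun j =>
      softDeriv_X_of_ne fun hj => h (by rw [← hj])
    rw [hself, Derivation.leibniz, derivation_prod_eq_zero _ _ _ (fun j _ => hX j),
      Derivation.leibniz, Derivation.leibniz, map_sub]
    have hm := hX m.2
    simp only [Prod.mk.eta] at hm
    simp [hm, ← MvPolynomial.algebraMap_eq]
  have hmem : m'.1 ∈ Finset.univ.erase m.1 := by simp [h.symm]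
  have hP : minMaxPoly K J =
      R m.1 * (R m'.1 * ∏ k ∈ (Finset.univ.erase m.1).erase m'.1, R k) := by
    rw [Finset.mul_prod_erase _ _ hmem, Finset.mul_prod_erase _ _ (Finset.mem_univ _), minMaxPoly]
  have hrest : ∀ n : K × J, n = m ∨ n = m' →
      softDeriv lam n (∏ k ∈ (Finset.univ.erase m.1).erase m'.1, R k) = 0 := fun n hn => by
    refine derivation_prod_eq_zero _ _ _ fun k hk => hzero _ _ ?_
    simp only [Finset.mem_erase, Finset.mem_univ, and_true] at hk
    rcases hn with rfl | rfl
    · exact hk.2.symm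
    · exact hk.1.symm
  have hD : softDeriv lam m' (softDeriv lam m (minMaxPoly K J)) =
      softDeriv lam m (R m.1) * (softDeriv lam m' (R m'.1) *
        ∏ k ∈ (Finset.univ.erase m.1).erase m'.1, R k) := by
    rw [hP, Derivation.leibniz, Derivation.leibniz (softDeriv lam m) (R m'.1),
      hrest m (.inl rfl), hzero m m'.1 h, smul_zero, smul_zero, add_zero, smul_zero, zero_add,
      smul_eq_mul, Derivation.leibniz, hzero', Derivation.leibniz, hrest m' (.inr rfl)]
    simp only [smul_eq_mul]
    ring
  have hq := fun n => softStep_mem_Icc lam c (x n)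
  rw [hD, hself, hself]
  simp only [softPoly, map_mul, map_prod, hR, map_sub, map_one, MvPolynomial.eval_C,
    MvPolynomial.eval_X]
  have h1 : ∀ n, 0 ≤ softStep lam c (x n) * (1 - softStep lam c (x n)) := fun n =>
    mul_nonneg (hq n).1 (sub_nonneg.2 (hq n).2)
  have h2 : ∀ (s : Finset J) k, 0 ≤ ∏ j ∈ s, softStep lam c (x (k, j)) := fun s k =>
    Finset.prod_nonneg fun j _ => (hq _).1
  have h3 : 0 ≤ ∏ k ∈ (Finset.univ.erase m.1).erase m'.1, (1 - ∏ j, softStep lam c (x (k, j))) :=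
    Finset.prod_nonneg fun k _ => sub_nonneg.2
      (Finset.prod_le_one (fun j _ => (hq _).1) fun j _ => (hq _).2)
  have h4 := mul_nonneg (mul_nonneg (mul_nonneg (mul_nonneg (h1 m) (h2 (Finset.univ.erase m.2) m.1))
    (mul_nonneg (h1 m') (h2 (Finset.univ.erase m'.2) m'.1))) h3) (mul_self_nonneg lam)
  exact h4.trans_eq (by ring)

/-- The pointwise limit of `softStep lam c` as `lam → ∞`. -/
def hardStep (c x : ℝ) : ℝ := if x < c then 1 else if x = c then 1 / 2 else 0

lemma tendsto_softStep (c x : ℝ) :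
    Tendsto (fun N : ℕ => softStep N c x) atTop (𝓝 (hardStep c x)) := by
  unfold softStep hardStep
  split_ifs with h1 h2
  · have : Tendsto (fun N : ℕ => Real.exp (N * (x - c))) atTop (𝓝 0) :=
      Real.tendsto_exp_atBot.comp
        (tendsto_natCast_atTop_atTop.atTop_mul_const_of_neg (sub_neg.2 h1))
    simpa using (this.const_add 1).inv₀ (by norm_num)
  · subst h2
    norm_num
  · have hx : 0 < x - c := sub_pos.2 (lt_of_le_of_ne (not_lt.1 h1) (Ne.symm h2))
    have : Tendsto (fun N : ℕ => Real.exp (N * (x - c))) atTop atTop :=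
      Real.tendsto_exp_atTop.comp (tendsto_natCast_atTop_atTop.atTop_mul_const hx)
    exact (tendsto_atTop_add_const_left _ 1 this).inv_tendsto_atTop

lemma hardStep_mem_Icc (c x : ℝ) : hardStep c x ∈ Set.Icc (0 : ℝ) 1 := by
  unfold hardStep
  split_ifs <;> norm_num

variable {ι ι' : Type*} [Fintype ι] [Fintype ι']

lemma tendsto_integral_minMaxPoly (c : ℝ) (A : K × J → ι → ℝ) :
    Tendsto (fun N : ℕ => ∫ x, softPoly N c (minMaxPoly K J) (fun m => ∑ i, A m i * x i) ∂gaussPi ι)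
      atTop (𝓝 (∫ x, ∏ k, (1 - ∏ j, hardStep c (∑ i, A (k, j) i * x i)) ∂gaussPi ι)) := by
  refine tendsto_integral_of_dominated_convergence (fun _ => 1)
    (fun N => (continuous_softPoly_linear _ c _ A).aestronglyMeasurable) (integrable_const _)
    (fun N => ae_of_all _ fun x => ?_) (ae_of_all _ fun x => ?_)
  · rw [softPoly_minMaxPoly, Real.norm_eq_abs, Finset.abs_prod]
    refine Finset.prod_le_one (fun _ _ => abs_nonneg _) fun k _ => ?_
    have h0 : 0 ≤ ∏ j, softStep N c (∑ i, A (k, j) i * x i) :=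
      Finset.prod_nonneg fun j _ => (softStep_mem_Icc _ _ _).1
    have h1 : ∏ j, softStep N c (∑ i, A (k, j) i * x i) ≤ 1 :=
      Finset.prod_le_one (fun j _ => (softStep_mem_Icc _ _ _).1) fun j _ =>
        (softStep_mem_Icc _ _ _).2
    rw [abs_le]
    constructor <;> linarith
  · simp only [softPoly_minMaxPoly]
    exact tendsto_finsetProd _ fun k _ => (tendsto_finsetProd _ fun j _ =>
      tendsto_softStep c _).const_sub 1

lemma hardMinMax_mem_Icc (c : ℝ) (y : K → J → ℝ) :
    ∏ k, (1 - ∏ j, hardStep c (y k j)) ∈ Set.Icc (0 : ℝ) 1 := by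
  have h : ∀ k, ∏ j, hardStep c (y k j) ∈ Set.Icc (0 : ℝ) 1 := fun k =>
    ⟨Finset.prod_nonneg fun j _ => (hardStep_mem_Icc _ _).1,
      Finset.prod_le_one (fun j _ => (hardStep_mem_Icc _ _).1) fun j _ => (hardStep_mem_Icc _ _).2⟩
  exact ⟨Finset.prod_nonneg fun k _ => sub_nonneg.2 (h k).2,
    Finset.prod_le_one (fun k _ => sub_nonneg.2 (h k).2) fun k _ => by linarith [(h k).1]⟩

lemma integrable_hardMinMax (c : ℝ) (A : K × J → ι → ℝ) :
    Integrable (fun x : ι → ℝ => ∏ k, (1 - ∏ j, hardStep c (∑ i, A (k, j) i * x i)))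
      (gaussPi ι) := by
  have hhard : Measurable (hardStep c) :=
    Measurable.ite measurableSet_Iio measurable_const
      (Measurable.ite (measurableSet_singleton c) measurable_const measurable_const)
  refine .of_bound (Measurable.aestronglyMeasurable ?_) 1 (ae_of_all _ fun x => ?_)
  · exact Finset.measurable_fun_prod _ fun k _ => (Finset.measurable_fun_prod _ fun j _ =>
      hhard.comp (by fun_prop)).const_sub 1
  · have h := hardMinMax_mem_Icc c fun k j => ∑ i, A (k, j) i * x i
    rw [Real.norm_eq_abs, abs_of_nonneg h.1]
    exact h.2

lemma measureReal_le_integral_hardMinMax (c : ℝ) (A : K × J → ι → ℝ) :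
    (gaussPi ι).real {x | ∀ k, ∃ j, c < ∑ i, A (k, j) i * x i} ≤
      ∫ x, ∏ k, (1 - ∏ j, hardStep c (∑ i, A (k, j) i * x i)) ∂gaussPi ι := by
  have hm : MeasurableSet {x : ι → ℝ | ∀ k, ∃ j, c < ∑ i, A (k, j) i * x i} := by
    simp only [Set.ofPred_forall, Set.ofPred_exists]
    exact .iInter fun k => .iUnion fun j => measurableSet_lt (by fun_prop) (by fun_prop)
  rw [← integral_indicator_one hm]
  refine integral_mono ((integrable_const (1 : ℝ)).indicator hm) (integrable_hardMinMax c A)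
    fun x => ?_
  refine Set.indicator_apply_le' (fun hx => ?_) fun _ => (hardMinMax_mem_Icc c _).1
  refine le_of_eq (Finset.prod_eq_one fun k _ => ?_).symm
  obtain ⟨j, hj⟩ := hx k
  rw [Finset.prod_eq_zero (Finset.mem_univ j), sub_zero]
  rw [hardStep, if_neg hj.not_gt, if_neg hj.ne']

lemma integral_hardMinMax_le_measureReal (c : ℝ) (A : K × J → ι → ℝ) :
    ∫ x, ∏ k, (1 - ∏ j, hardStep c (∑ i, A (k, j) i * x i)) ∂gaussPi ι ≤
      (gaussPi ι).real {x | ∀ k, ∃ j, c ≤ ∑ i, A (k, j) i * x i} := by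
  have hm : MeasurableSet {x : ι → ℝ | ∀ k, ∃ j, c ≤ ∑ i, A (k, j) i * x i} := by
    simp only [Set.ofPred_forall, Set.ofPred_exists]
    exact .iInter fun k => .iUnion fun j => measurableSet_le (by fun_prop) (by fun_prop)
  rw [← integral_indicator_one hm]
  refine integral_mono (integrable_hardMinMax c A) ((integrable_const (1 : ℝ)).indicator hm)
    fun x => ?_
  refine Set.le_indicator_apply (fun _ => (hardMinMax_mem_Icc c _).2) fun hx => ?_
  simp only [Set.mem_ofPred_eq, not_forall, not_exists, not_le] at hx
  obtain ⟨k, hk⟩ := hx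
  refine le_of_eq (Finset.prod_eq_zero (Finset.mem_univ k) ?_)
  rw [Finset.prod_eq_one fun j _ => by rw [hardStep, if_pos (hk j)], sub_self]

/-- Gordon's min-max comparison inequality for finite families. -/
theorem gordon_finite (c : ℝ) (A : K × J → ι → ℝ) (B : K × J → ι' → ℝ)
    (hsame : ∀ k j j', ∑ i, A (k, j) i * A (k, j') i = ∑ i, B (k, j) i * B (k, j') i)
    (hle : ∀ m m', ∑ i, B m i * B m' i ≤ ∑ i, A m i * A m' i) :
    gaussPi ι' {x | ∀ k, ∃ j, c < ∑ i, B (k, j) i * x i} ≤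
      gaussPi ι {x | ∀ k, ∃ j, c ≤ ∑ i, A (k, j) i * x i} := by
  classical
  have hlim := le_of_tendsto_of_tendsto' (tendsto_integral_minMaxPoly c B)
    (tendsto_integral_minMaxPoly c A) fun N =>
      integral_softPoly_le_of_cov (N : ℝ) c (minMaxPoly K J) A B fun m m' x => by
        by_cases h : m.1 = m'.1
        · obtain ⟨k, j⟩ := m
          obtain ⟨k', j'⟩ := m'
          obtain rfl : k = k' := h
          rw [hsame, sub_self, zero_mul]
        · exact mul_nonneg (sub_nonneg.2 (hle m m'))
            (softPoly_softDeriv_softDeriv_minMaxPoly_nonneg c h x)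
  have h := (measureReal_le_integral_hardMinMax c B).trans
    (hlim.trans (integral_hardMinMax_le_measureReal c A))
  exact (ENNReal.toReal_le_toReal (measure_ne_top _ _) (measure_ne_top _ _)).1 h

end Gordon

/-- Gordon's min-max comparison inequality for countable families. -/
theorem gordon_countable {ι ι' : Type*} [Fintype ι] [Fintype ι'] (c : ℝ)
    (A : ℕ → ℕ → ι → ℝ) (B : ℕ → ℕ → ι' → ℝ)
    (hsame : ∀ k j j', ∑ i, A k j i * A k j' i = ∑ i, B k j i * B k j' i)
    (hle : ∀ k j k' j', ∑ i, B k j i * B k' j' i ≤ ∑ i, A k j i * A k' j' i) :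
    gaussPi ι' {x | ∀ k, ∃ j, c < ∑ i, B k j i * x i} ≤
      gaussPi ι {x | ∀ k, ∃ j, c ≤ ∑ i, A k j i * x i} := by
  have hfin : ∀ K J : ℕ, gaussPi ι' {x | ∀ k < K, ∃ j < J, c < ∑ i, B k j i * x i} ≤
      gaussPi ι {x | ∀ k < K, ∃ j < J, c ≤ ∑ i, A k j i * x i} := fun K J => by
    have h := gordon_finite (K := Fin K) (J := Fin J) c (fun m => A m.1 m.2) (fun m => B m.1 m.2)
      (fun k j j' => hsame _ _ _) (fun m m' => hle _ _ _ _)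
    convert h using 4
    all_goals simp [Fin.forall_iff, Fin.exists_iff]
  have hK : ∀ K : ℕ, gaussPi ι' {x | ∀ k < K, ∃ j, c < ∑ i, B k j i * x i} ≤
      gaussPi ι {x | ∀ k < K, ∃ j, c ≤ ∑ i, A k j i * x i} := fun K => by
    have hB : {x : ι' → ℝ | ∀ k < K, ∃ j, c < ∑ i, B k j i * x i} =
        ⋃ J : ℕ, {x | ∀ k < K, ∃ j < J, c < ∑ i, B k j i * x i} := by
      ext x
      simp only [Set.mem_ofPred_eq, Set.mem_iUnion]
      refine ⟨fun h => ?_, fun ⟨J, h⟩ k hk => (h k hk).imp fun j hj => hj.2⟩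
      choose! f hf using h
      refine ⟨(Finset.range K).sup f + 1, fun k hk => ⟨f k, ?_, hf k hk⟩⟩
      exact Nat.lt_succ_of_le (Finset.le_sup (f := f) (Finset.mem_range.2 hk))
    rw [hB, Monotone.measure_iUnion]
    · refine iSup_le fun J => (hfin K J).trans (measure_mono fun x hx k hk => ?_)
      exact (hx k hk).imp fun j hj => hj.2
    · intro J J' hJ x hx k hk
      exact (hx k hk).imp fun j hj => ⟨hj.1.trans_le hJ, hj.2⟩
  have hA : {x : ι → ℝ | ∀ k, ∃ j, c ≤ ∑ i, A k j i * x i} =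
      ⋂ K : ℕ, {x | ∀ k < K, ∃ j, c ≤ ∑ i, A k j i * x i} := by
    ext x
    simp only [Set.mem_ofPred_eq, Set.mem_iInter]
    exact ⟨fun h K k _ => h k, fun h k => h (k + 1) k (Nat.lt_succ_self k)⟩
  rw [hA, Antitone.measure_iInter]
  · refine le_iInf fun K => le_trans (measure_mono ?_) (hK K)
    exact fun x hx k _ => hx k
  · intro K K' hK x hx k hk
    exact hx k (hk.trans_le hK)
  · refine fun K => MeasurableSet.nullMeasurableSet ?_
    simp only [Set.ofPred_forall, Set.ofPred_exists]
    exact .iInter fun k => .iInter fun _ => .iUnion fun j =>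
      measurableSet_le (by fun_prop) (by fun_prop)
  · exact ⟨0, measure_ne_top _ _⟩


section Escape

lemma measurePreserving_uncurry_gaussPi (ι ι' : Type*) [Fintype ι] [Fintype ι'] :
    MeasurePreserving (fun (H : ι → ι' → ℝ) (q : ι × ι') => H q.1 q.2)
      (Measure.pi fun _ : ι => gaussPi ι') (gaussPi (ι × ι')) := by
  refine ⟨by fun_prop, ?_⟩
  refine (Measure.pi_eq fun s hs => ?_).symm
  rw [Measure.map_apply (by fun_prop) (MeasurableSet.univ_pi hs)]
  have : (fun (H : ι → ι' → ℝ) (q : ι × ι') => H q.1 q.2) ⁻¹' (Set.univ.pi s) =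
      Set.univ.pi fun i => Set.univ.pi fun l => s (i, l) := by
    ext H
    simp only [Set.mem_preimage, Set.mem_pi, Set.mem_univ, true_imp_iff]
    exact ⟨fun h i l => h (i, l), fun h q => h q.1 q.2⟩
  rw [this, Measure.pi_pi, Fintype.prod_prod_type]
  exact Finset.prod_congr rfl fun i _ => Measure.pi_pi _ _

lemma sum_mul_le_one_of_sq {ι : Type*} [Fintype ι] {u v : ι → ℝ} (hu : ∑ i, u i ^ 2 = 1)
    (hv : ∑ i, v i ^ 2 = 1) : ∑ i, u i * v i ≤ 1 := by
  have h : 0 ≤ ∑ i, (u i - v i) ^ 2 := Finset.sum_nonneg fun _ _ => sq_nonneg _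
  have h' : ∑ i, (u i - v i) ^ 2 = ∑ i, u i ^ 2 + ∑ i, v i ^ 2 - 2 * ∑ i, u i * v i := by
    rw [Finset.mul_sum, ← Finset.sum_add_distrib, ← Finset.sum_sub_distrib]
    exact Finset.sum_congr rfl fun _ _ => by ring
  linarith

lemma abs_sum_mul_lt_of_sq {ι : Type*} [Fintype ι] {u v : ι → ℝ} {r : ℝ} (hr : 0 ≤ r)
    (hu : ∑ i, u i ^ 2 = 1) (hv : ∑ i, v i ^ 2 < r ^ 2) : |∑ i, u i * v i| < r := by
  refine abs_lt_of_sq_lt_sq ?_ hr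
  have := Finset.sum_mul_sq_le_sq_mul_sq Finset.univ u v
  rw [hu, one_mul] at this
  exact this.trans_lt hv

/-- Escape through a mesh, obtained from Gordon's comparison theorem. -/
theorem measure_escape_le {n p : ℕ} (T : Set (Fin n → ℝ)) (hT : ∀ u ∈ T, ∑ i, u i ^ 2 = 1)
    {c r : ℝ} (hc : 0 < c) (hr : 0 ≤ r) :
    (Measure.pi fun _ : Fin n => gaussPi (Fin p))
        {H | ¬ ∀ b : Fin p → ℝ, b ≠ 0 → ∃ u ∈ T, 0 < ∑ i, u i * ∑ l, H i l * b l} ≤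
      gauss {x | c ≤ x} + gaussPi (Fin p) {h | r ^ 2 ≤ ∑ l, h l ^ 2} +
        gaussPi (Fin n) {g | ¬ ∃ u ∈ T, r + 2 * c < ∑ i, u i * g i} := by
  rcases T.eq_empty_or_nonempty with rfl | hTne
  · refine prob_le_one.trans (le_trans (le_of_eq ?_) le_add_self)
    simp
  rcases Nat.eq_zero_or_pos p with rfl | hp
  · have hempty : {H : Fin n → Fin 0 → ℝ | ¬ ∀ b : Fin 0 → ℝ, b ≠ 0 →
        ∃ u ∈ T, 0 < ∑ i, u i * ∑ l, H i l * b l} = ∅ :=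
      Set.eq_empty_iff_forall_notMem.2 fun H hH =>
        hH fun b hb => absurd (Subsingleton.elim _ _) hb
    rw [hempty, measure_empty]
    exact zero_le
  let S : Set (Fin p → ℝ) := {b | ∑ l, b l ^ 2 = 1}
  have hSne : S.Nonempty := ⟨Pi.single ⟨0, hp⟩ 1, by
    simp only [S, Set.mem_ofPred_eq]
    rw [Finset.sum_eq_single ⟨0, hp⟩]
    · simp
    · intro b _ hb; simp [hb]
    · simp⟩
  have := hTne.to_subtype
  have := hSne.to_subtype
  obtain ⟨u, hu⟩ := TopologicalSpace.exists_dense_seq T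
  obtain ⟨b, hb⟩ := TopologicalSpace.exists_dense_seq S
  have hu1 : ∀ j, ∑ i, (u j : Fin n → ℝ) i ^ 2 = 1 := fun j => hT _ (u j).2
  have hb1 : ∀ k, ∑ i, (b k : Fin p → ℝ) i ^ 2 = 1 := fun k => (b k).2
  let A : ℕ → ℕ → (Fin n × Fin p) ⊕ Unit → ℝ := fun k j =>
    Sum.elim (fun q => (u j : Fin n → ℝ) q.1 * (b k : Fin p → ℝ) q.2) (fun _ => 1)
  let B : ℕ → ℕ → Fin n ⊕ Fin p → ℝ := fun k j => Sum.elim (u j) (b k)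
  have hA : ∀ k j k' j', ∑ i, A k j i * A k' j' i =
      (∑ i, (u j : Fin n → ℝ) i * (u j' : Fin n → ℝ) i) *
        (∑ l, (b k : Fin p → ℝ) l * (b k' : Fin p → ℝ) l) + 1 := by
    intro k j k' j'
    simp only [A, Fintype.sum_sum_type, Sum.elim_inl, Sum.elim_inr, Fintype.sum_prod_type,
      Finset.sum_mul_sum]
    simp [mul_mul_mul_comm]
  have hB : ∀ k j k' j', ∑ i, B k j i * B k' j' i =
      (∑ i, (u j : Fin n → ℝ) i * (u j' : Fin n → ℝ) i) +
        (∑ l, (b k : Fin p → ℝ) l * (b k' : Fin p → ℝ) l) := by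
    intro k j k' j'
    simp only [B, Fintype.sum_sum_type, Sum.elim_inl, Sum.elim_inr]
  have key := gordon_countable (2 * c) A B (fun k j j' => by
      have : ∑ l, (b k : Fin p → ℝ) l * (b k : Fin p → ℝ) l = 1 := by
        simpa only [sq] using hb1 k
      rw [hA, hB, this]; ring) (fun k j k' j' => by
      rw [hA, hB]
      nlinarith [mul_nonneg (sub_nonneg.2 (sum_mul_le_one_of_sq (hu1 j) (hu1 j')))
        (sub_nonneg.2 (sum_mul_le_one_of_sq (hb1 k) (hb1 k')))])
  let Good : Set (Fin n × Fin p → ℝ) :=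
    {x | ∀ k, ∃ j, c ≤ ∑ q : Fin n × Fin p, (u j : Fin n → ℝ) q.1 * (b k : Fin p → ℝ) q.2 * x q}
  have hGoodMeas : MeasurableSet Good := by
    simp only [Good, Set.ofPred_forall, Set.ofPred_exists]
    exact .iInter fun k => .iUnion fun j => measurableSet_le (by fun_prop) (by fun_prop)
  -- upper bound for the product process
  have hup : gaussPi ((Fin n × Fin p) ⊕ Unit) {x | ∀ k, ∃ j, 2 * c ≤ ∑ i, A k j i * x i} ≤
      gauss {x | c ≤ x} + gaussPi (Fin n × Fin p) Good := by
    have hsub : {x : (Fin n × Fin p) ⊕ Unit → ℝ | ∀ k, ∃ j, 2 * c ≤ ∑ i, A k j i * x i} ⊆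
        ((fun x : (Fin n × Fin p) ⊕ Unit → ℝ => x (Sum.inr ())) ⁻¹' {x | c ≤ x}) ∪
        ((fun x : (Fin n × Fin p) ⊕ Unit → ℝ => fun i => x (Sum.inl i)) ⁻¹' Good) := by
      intro x hx
      by_cases h : c ≤ x (Sum.inr ())
      · exact Or.inl h
      · refine Or.inr fun k => ?_
        obtain ⟨j, hj⟩ := hx k
        refine ⟨j, ?_⟩
        simp only [A, Fintype.sum_sum_type, Sum.elim_inl, Sum.elim_inr, Finset.univ_unique,
          Finset.sum_singleton, one_mul] at hj
        have hd : (default : Unit) = () := rfl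
        rw [hd] at hj
        push Not at h
        linarith
    refine (measure_mono hsub).trans ((measure_union_le _ _).trans (add_le_add ?_ ?_))
    · exact (measurePreserving_eval (fun _ : (Fin n × Fin p) ⊕ Unit => gauss)
        (Sum.inr ())).measure_preimage_le _
    · exact (measurePreserving_inl_gaussPi (Fin n × Fin p) Unit).measure_preimage_le _
  -- lower bound for the decoupled process
  have hlow : 1 ≤ gaussPi (Fin n ⊕ Fin p) {x | ∀ k, ∃ j, 2 * c < ∑ i, B k j i * x i} +
      gaussPi (Fin p) {h | r ^ 2 ≤ ∑ l, h l ^ 2} +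
        gaussPi (Fin n) {g | ¬ ∃ u ∈ T, r + 2 * c < ∑ i, u i * g i} := by
    have hsub : (Set.univ : Set (Fin n ⊕ Fin p → ℝ)) ⊆
        {x | ∀ k, ∃ j, 2 * c < ∑ i, B k j i * x i} ∪
        ((fun x : Fin n ⊕ Fin p → ℝ => fun i => x (Sum.inr i)) ⁻¹' {h | r ^ 2 ≤ ∑ l, h l ^ 2}) ∪
        ((fun x : Fin n ⊕ Fin p → ℝ => fun i => x (Sum.inl i)) ⁻¹'
          {g | ¬ ∃ u ∈ T, r + 2 * c < ∑ i, u i * g i}) := by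
      intro x _
      by_cases h1 : r ^ 2 ≤ ∑ l, x (Sum.inr l) ^ 2
      · exact Or.inl (Or.inr h1)
      by_cases h2 : ∃ u ∈ T, r + 2 * c < ∑ i, u i * x (Sum.inl i)
      · refine Or.inl (Or.inl fun k => ?_)
        obtain ⟨v, hv, hv2⟩ := h2
        have hopen : IsOpen {w : T | r + 2 * c < ∑ i, (w : Fin n → ℝ) i * x (Sum.inl i)} :=
          isOpen_lt continuous_const (continuous_finsetSum _ fun i _ =>
            ((continuous_apply i).comp continuous_subtype_val).mul continuous_const)
        obtain ⟨j, hj⟩ := hu.exists_mem_open hopen ⟨⟨v, hv⟩, hv2⟩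
        refine ⟨j, ?_⟩
        have h3 := abs_lt.1 (abs_sum_mul_lt_of_sq hr (hb1 k) (not_le.1 h1))
        simp only [B, Fintype.sum_sum_type, Sum.elim_inl, Sum.elim_inr]
        simp only [Set.mem_ofPred_eq] at hj
        linarith [h3.1]
      · exact Or.inr h2
    rw [← measure_univ (μ := gaussPi (Fin n ⊕ Fin p))]
    refine (measure_mono hsub).trans ((measure_union_le _ _).trans (add_le_add
      ((measure_union_le _ _).trans (add_le_add le_rfl ?_)) ?_))
    · exact (measurePreserving_inr_gaussPi _ _).measure_preimage_le _
    · exact (measurePreserving_inl_gaussPi _ _).measure_preimage_le _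
  -- the random matrix event contains the countable one
  have hbad : (Measure.pi fun _ : Fin n => gaussPi (Fin p))
        {H | ¬ ∀ b : Fin p → ℝ, b ≠ 0 → ∃ u ∈ T, 0 < ∑ i, u i * ∑ l, H i l * b l} ≤
      gaussPi (Fin n × Fin p) Goodᶜ := by
    refine le_trans (measure_mono ?_)
      ((measurePreserving_uncurry_gaussPi (Fin n) (Fin p)).measure_preimage_le Goodᶜ)
    intro H hH hG
    refine hH fun v hv => ?_
    have hs : 0 < ∑ l, v l ^ 2 := by
      obtain ⟨l, hl⟩ := Function.ne_iff.1 hv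
      exact Finset.sum_pos' (fun _ _ => sq_nonneg _) ⟨l, Finset.mem_univ _, by
        simpa using pow_pos (abs_pos.2 hl) 2⟩
    set s := Real.sqrt (∑ l, v l ^ 2) with hsdef
    have hs0 : 0 < s := Real.sqrt_pos.2 hs
    have hss : s ^ 2 = ∑ l, v l ^ 2 := Real.sq_sqrt hs.le
    let w : Fin p → ℝ := fun l => v l / s
    have hw : w ∈ S := by
      simp only [S, w, Set.mem_ofPred_eq, div_pow]
      rw [← Finset.sum_div, hss, div_self hs.ne']
    have hopen : IsOpen {b' : S | ∑ i, (∑ l, H i l * (w l - (b' : Fin p → ℝ) l)) ^ 2 < c ^ 2} :=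
      isOpen_lt (continuous_finsetSum _ fun i _ => (continuous_finsetSum _ fun l _ =>
        continuous_const.mul (continuous_const.sub
          ((continuous_apply l).comp continuous_subtype_val))).pow 2) continuous_const
    obtain ⟨k, hk⟩ := hb.exists_mem_open hopen ⟨⟨w, hw⟩, by
      simp only [Set.mem_ofPred_eq, sub_self, mul_zero, Finset.sum_const_zero]
      simpa using pow_pos hc 2⟩
    obtain ⟨j, hj⟩ := hG k
    refine ⟨u j, (u j).2, ?_⟩
    have h3 := (abs_lt.1 (abs_sum_mul_lt_of_sq hc.le (hu1 j) hk)).1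
    have h4 : ∑ q : Fin n × Fin p, (u j : Fin n → ℝ) q.1 * (b k : Fin p → ℝ) q.2 * H q.1 q.2 =
        ∑ i, (u j : Fin n → ℝ) i * ∑ l, H i l * (b k : Fin p → ℝ) l := by
      rw [Fintype.sum_prod_type]
      refine Finset.sum_congr rfl fun i _ => ?_
      rw [Finset.mul_sum]
      exact Finset.sum_congr rfl fun l _ => by ring
    have h5 : ∑ i, (u j : Fin n → ℝ) i * ∑ l, H i l * (w l - (b k : Fin p → ℝ) l) =
        ∑ i, (u j : Fin n → ℝ) i * ∑ l, H i l * w l -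
          ∑ i, (u j : Fin n → ℝ) i * ∑ l, H i l * (b k : Fin p → ℝ) l := by
      simp only [mul_sub, Finset.sum_sub_distrib]
    have h6 : ∑ i, (u j : Fin n → ℝ) i * ∑ l, H i l * v l =
        s * ∑ i, (u j : Fin n → ℝ) i * ∑ l, H i l * w l := by
      simp only [Finset.mul_sum, w]
      refine Finset.sum_congr rfl fun i _ => Finset.sum_congr rfl fun l _ => ?_
      field_simp
    rw [h6]
    rw [h4] at hj
    exact mul_pos hs0 (by linarith)
  have hfin : gaussPi (Fin n × Fin p) Good ≠ ⊤ := measure_ne_top _ _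
  refine hbad.trans ?_
  have htot : gaussPi (Fin n × Fin p) Goodᶜ + gaussPi (Fin n × Fin p) Good ≤
      (gauss {x | c ≤ x} + gaussPi (Fin p) {h | r ^ 2 ≤ ∑ l, h l ^ 2} +
        gaussPi (Fin n) {g | ¬ ∃ u ∈ T, r + 2 * c < ∑ i, u i * g i}) +
        gaussPi (Fin n × Fin p) Good := by
    rw [add_comm, prob_add_prob_compl hGoodMeas]
    refine hlow.trans ?_
    refine (add_le_add (add_le_add (key.trans hup) le_rfl) le_rfl).trans (le_of_eq ?_)
    ring
  exact (ENNReal.add_le_add_iff_right hfin).1 htot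

end Escape

section Deterministic

lemma max_zero_le_rho (t : ℝ) : max 0 t ≤ rho t := by
  unfold rho
  refine max_le (Real.log_nonneg (by linarith [Real.exp_pos t])) ?_
  calc t = Real.log (Real.exp t) := (Real.log_exp t).symm
    _ ≤ _ := Real.log_le_log (Real.exp_pos t) (by linarith)

lemma continuous_rho : Continuous rho := by
  unfold rho
  exact (continuous_const.add Real.continuous_exp).log fun t =>
    (add_pos one_pos (Real.exp_pos t)).ne'

lemma continuous_negLogLik {n p : ℕ} (X : Fin n → Fin p → ℝ) (y : Fin n → ℝ) :
    Continuous (negLogLik X y) := by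
  unfold negLogLik
  have := continuous_rho
  fun_prop

lemma max_zero_le_logLik_term {y s : ℝ} (hy : y = 0 ∨ y = 1) :
    max 0 (-((2 * y - 1) * s)) ≤ rho s - y * s := by
  have h := max_le_iff.1 (max_zero_le_rho s)
  rcases hy with rfl | rfl
  · refine max_le ?_ ?_ <;> linarith [h.1, h.2]
  · refine max_le ?_ ?_ <;> linarith [h.1, h.2]

/-- If the data are not separable, even weakly, then the maximum likelihood estimator exists. -/
theorem exists_min_negLogLik {n p : ℕ} (X : Fin n → Fin p → ℝ) (y : Fin n → ℝ)
    (hy : ∀ i, y i = 0 ∨ y i = 1)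
    (h : ∀ b : Fin p → ℝ, b ≠ 0 → ∃ i, (2 * y i - 1) * ∑ j, X i j * b j < 0) :
    ∃ b, ∀ b', negLogLik X y b ≤ negLogLik X y b' := by
  rcases Nat.eq_zero_or_pos p with rfl | hp
  · exact ⟨0, fun b' => le_of_eq (congrArg _ (Subsingleton.elim _ _))⟩
  have : Nonempty (Fin p) := ⟨⟨0, hp⟩⟩
  let m : (Fin p → ℝ) → ℝ := fun b => ∑ i, max 0 (-((2 * y i - 1) * ∑ j, X i j * b j))
  have hm : Continuous m := by fun_prop
  have hmle : ∀ b, m b ≤ negLogLik X y b := fun b =>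
    Finset.sum_le_sum fun i _ => max_zero_le_logLik_term (hy i)
  have hmpos : ∀ b, b ≠ 0 → 0 < m b := by
    intro b hb
    obtain ⟨i, hi⟩ := h b hb
    exact Finset.sum_pos' (fun _ _ => le_max_left _ _)
      ⟨i, Finset.mem_univ _, lt_max_of_lt_right (by linarith)⟩
  have hmhom : ∀ (r : ℝ) b, 0 ≤ r → m (r • b) = r * m b := by
    intro r b hr
    simp only [m, Pi.smul_apply, smul_eq_mul]
    rw [Finset.mul_sum]
    refine Finset.sum_congr rfl fun i _ => ?_
    have hlin : ∑ j, X i j * (r * b j) = r * ∑ j, X i j * b j := by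
      rw [Finset.mul_sum]
      exact Finset.sum_congr rfl fun j _ => by ring
    rw [mul_max_of_nonneg _ _ hr, mul_zero, hlin]
    congr 1
    ring
  obtain ⟨b₀, hb₀, hmin⟩ := (isCompact_sphere (0 : Fin p → ℝ) 1).exists_isMinOn
    (NormedSpace.sphere_nonempty.2 zero_le_one) hm.continuousOn
  have hb₀' : 0 < m b₀ := hmpos b₀ (ne_zero_of_mem_unit_sphere ⟨b₀, hb₀⟩)
  refine (continuous_negLogLik X y).exists_forall_le ?_
  refine tendsto_atTop_mono (f := fun b => m b₀ * ‖b‖) (fun b => ?_)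
    ((tendsto_norm_cocompact_atTop (E := Fin p → ℝ)).const_mul_atTop hb₀')
  refine le_trans ?_ (hmle b)
  rcases eq_or_ne b 0 with rfl | hb
  · rw [norm_zero, mul_zero]
    exact Finset.sum_nonneg fun _ _ => le_max_left _ _
  have hnb : 0 < ‖b‖ := norm_pos_iff.2 hb
  have h1 : m b = ‖b‖ * m (‖b‖⁻¹ • b) := by
    rw [← hmhom _ _ hnb.le, smul_smul, mul_inv_cancel₀ hnb.ne', one_smul]
  rw [h1, mul_comm]
  refine mul_le_mul_of_nonneg_left (hmin ?_) hnb.le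
  rw [mem_sphere_zero_iff_norm, norm_smul, norm_inv, norm_norm, inv_mul_cancel₀ hnb.ne']

/-- Nonnegative unit vectors orthogonal to `V`. -/
def conicSphere {n : ℕ} (V : Fin n → ℝ) : Set (Fin n → ℝ) :=
  {u | (∀ i, 0 ≤ u i) ∧ ∑ i, u i * V i = 0 ∧ ∑ i, u i ^ 2 = 1}

lemma max_add_sq_le (x y : ℝ) :
    max (x + y) 0 ^ 2 ≤ max x 0 ^ 2 + 2 * max x 0 * y + y ^ 2 := by
  rcases le_total x 0 with hx | hx <;> rcases le_total (x + y) 0 with hxy | hxy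
  · simp only [max_eq_right hx, max_eq_right hxy]; nlinarith [sq_nonneg y]
  · simp only [max_eq_right hx, max_eq_left hxy]; nlinarith
  · simp only [max_eq_left hx, max_eq_right hxy]; nlinarith [sq_nonneg (x + y)]
  · simp only [max_eq_left hx, max_eq_left hxy]; nlinarith

/-- A lower bound on the residual `∑ (gᵢ - t Vᵢ)₊²` yields a direction in `conicSphere V` which is
well aligned with `g`. -/
theorem exists_mem_conicSphere_lt {n : ℕ} (g V : Fin n → ℝ) (hneg : ∃ i, V i < 0)
    (hpos : ∃ i, 0 < V i) {R : ℝ}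
    (h : ∀ t, R ^ 2 < ∑ i, max (g i - t * V i) 0 ^ 2) :
    ∃ u ∈ conicSphere V, R < ∑ i, u i * g i := by
  let F : ℝ → ℝ := fun t => ∑ i, max (g i - t * V i) 0 ^ 2
  have hF : Continuous F := by fun_prop
  have hterm : ∀ i t, g i - t * V i ≤ F t + 1 := by
    intro i t
    have h1 : max (g i - t * V i) 0 ^ 2 ≤ F t :=
      Finset.single_le_sum (f := fun i => max (g i - t * V i) 0 ^ 2)
        (fun _ _ => sq_nonneg _) (Finset.mem_univ i)
    nlinarith [le_max_left (g i - t * V i) 0, sq_nonneg (max (g i - t * V i) 0 - 1),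
      le_max_right (g i - t * V i) 0]
  have hcoer : Tendsto F (cocompact ℝ) atTop := by
    rw [cocompact_eq_atBot_atTop, tendsto_sup]
    constructor
    · obtain ⟨i, hi⟩ := hpos
      refine tendsto_atTop_mono (f := fun t => (g i - 1) + (-V i) * t) (fun t => ?_) ?_
      · linarith [hterm i t]
      · exact tendsto_atTop_add_const_left _ _
          (tendsto_id.const_mul_atBot_of_neg (neg_lt_zero.2 hi))
    · obtain ⟨i, hi⟩ := hneg
      refine tendsto_atTop_mono (f := fun t => (g i - 1) + (-V i) * t) (fun t => ?_) ?_
      · linarith [hterm i t]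
      · exact tendsto_atTop_add_const_left _ _
          (tendsto_id.const_mul_atTop (neg_pos.2 hi))
  obtain ⟨t, ht⟩ := hF.exists_forall_le hcoer
  set a : Fin n → ℝ := fun i => max (g i - t * V i) 0 with ha
  set D := ∑ i, a i * V i with hD
  set Q := ∑ i, V i ^ 2 with hQ
  have hQ0 : 0 ≤ Q := Finset.sum_nonneg fun _ _ => sq_nonneg _
  have hexp : ∀ s, F (t + s) ≤ F t - 2 * s * D + s ^ 2 * Q := by
    intro s
    have : F t - 2 * s * D + s ^ 2 * Q =
        ∑ i, (a i ^ 2 + 2 * a i * (-(s * V i)) + (-(s * V i)) ^ 2) := by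
      simp only [F, hD, hQ, Finset.mul_sum, ← Finset.sum_sub_distrib, ← Finset.sum_add_distrib, ha]
      exact Finset.sum_congr rfl fun i _ => by ring
    rw [this]
    refine Finset.sum_le_sum fun i _ => ?_
    have := max_add_sq_le (g i - t * V i) (-(s * V i))
    rwa [show g i - t * V i + -(s * V i) = g i - (t + s) * V i by ring] at this
  have hD0 : D = 0 := by
    have h1 := (ht (t + D / (Q + 1))).trans (hexp (D / (Q + 1)))
    have h2 : 2 * (D / (Q + 1)) * D ≤ (D / (Q + 1)) ^ 2 * Q := by linarith
    have hQ1 : 0 < Q + 1 := by linarith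
    have h3 : D ^ 2 * (Q + 2) ≤ 0 := by
      rw [div_pow] at h2
      have h4 := mul_le_mul_of_nonneg_right h2 (sq_nonneg (Q + 1))
      have h5 : D ^ 2 / (Q + 1) ^ 2 * Q * (Q + 1) ^ 2 = D ^ 2 * Q := by field_simp
      have h6 : 2 * (D / (Q + 1)) * D * (Q + 1) ^ 2 = 2 * D ^ 2 * (Q + 1) := by field_simp
      rw [h5, h6] at h4
      linarith
    have : D ^ 2 ≤ 0 := by nlinarith [sq_nonneg D]
    exact pow_eq_zero_iff two_ne_zero |>.1 (le_antisymm this (sq_nonneg D))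
  have hFt : F t = ∑ i, a i ^ 2 := rfl
  have hFpos : 0 < F t := (sq_nonneg R).trans_lt (h t)
  have hag : ∑ i, a i * g i = F t := by
    have h1 : ∑ i, a i * g i = ∑ i, a i ^ 2 + t * D := by
      simp only [hD, Finset.mul_sum, ← Finset.sum_add_distrib]
      refine Finset.sum_congr rfl fun i _ => ?_
      simp only [ha]
      rcases le_total (g i - t * V i) 0 with hx | hx
      · simp [max_eq_right hx]
      · simp only [max_eq_left hx]; ring
    rw [h1, hD0, mul_zero, add_zero]
  have hs : 0 < Real.sqrt (F t) := Real.sqrt_pos.2 hFpos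
  refine ⟨fun i => a i / Real.sqrt (F t), ⟨fun i => div_nonneg (le_max_right _ _) hs.le, ?_, ?_⟩,
    ?_⟩
  · simp only [div_mul_eq_mul_div, ← Finset.sum_div]
    rw [← hD, hD0, zero_div]
  · simp only [div_pow, ← Finset.sum_div]
    rw [Real.sq_sqrt hFpos.le, ← hFt, div_self hFpos.ne']
  · simp only [div_mul_eq_mul_div, ← Finset.sum_div]
    rw [hag, Real.div_sqrt]
    exact Real.lt_sqrt_of_sq_lt (h t)

/-- A weakly separating direction prevents the random matrix `H` from escaping
`conicSphere V`. -/
theorem not_escape_of_separated {n p : ℕ} {V : Fin n → ℝ} (hV : ∀ i, V i ≠ 0)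
    (H : Fin n → Fin p → ℝ) (e b : Fin p → ℝ) (hb : b ≠ 0)
    (h : ∀ i, 0 ≤ ∑ l, (V i * e l + (H i l - (∑ m, e m * H i m) * e l)) * b l) :
    ¬ ∀ b : Fin p → ℝ, b ≠ 0 → ∃ u ∈ conicSphere V, 0 < ∑ i, u i * ∑ l, H i l * b l := by
  intro hesc
  set s := ∑ l, e l * b l with hs
  have hW : ∀ i, ∑ l, (V i * e l + (H i l - (∑ m, e m * H i m) * e l)) * b l =
      V i * s + ∑ l, H i l * (b l - s * e l) := by
    intro i
    have h1 : ∑ l, (V i * e l + (H i l - (∑ m, e m * H i m) * e l)) * b l =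
        V i * s + (∑ l, H i l * b l - (∑ m, e m * H i m) * s) := by
      simp only [hs, Finset.mul_sum, ← Finset.sum_sub_distrib, ← Finset.sum_add_distrib]
      refine Finset.sum_congr rfl fun l _ => by ring
    have h2 : ∑ l, H i l * (b l - s * e l) = ∑ l, H i l * b l - (∑ m, e m * H i m) * s := by
      simp only [Finset.sum_mul, ← Finset.sum_sub_distrib]
      exact Finset.sum_congr rfl fun l _ => by ring
    rw [h1, h2]
  by_cases hP : (fun l => s * e l - b l) = 0
  · have hP' : ∀ l, b l - s * e l = 0 := fun l => by
      have := congrFun hP l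
      simp only [Pi.zero_apply] at this
      linarith
    have hs0 : s ≠ 0 := by
      intro h0
      refine hb (funext fun l => ?_)
      simpa [h0] using hP' l
    obtain ⟨u, ⟨hu0, huV, hu1⟩, -⟩ := hesc b hb
    have hpos : ∀ i, 0 < V i * s := by
      intro i
      have h1 := h i
      rw [hW] at h1
      simp only [hP', mul_zero, Finset.sum_const_zero, add_zero] at h1
      exact lt_of_le_of_ne h1 (mul_ne_zero (hV i) hs0).symm
    have hsum : ∑ i, u i * (V i * s) = 0 := by
      simp only [← mul_assoc, ← Finset.sum_mul, huV, zero_mul]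
    have hz := (Finset.sum_eq_zero_iff_of_nonneg
      (fun i _ => mul_nonneg (hu0 i) (hpos i).le)).1 hsum
    have hu : ∀ i, u i = 0 := fun i =>
      (mul_eq_zero.1 (hz i (Finset.mem_univ i))).resolve_right (hpos i).ne'
    simp [hu] at hu1
  · obtain ⟨u, ⟨hu0, huV, -⟩, hu⟩ := hesc _ hP
    have h1 : 0 ≤ ∑ i, u i * (V i * s + ∑ l, H i l * (b l - s * e l)) :=
      Finset.sum_nonneg fun i _ => mul_nonneg (hu0 i) (by rw [← hW]; exact h i)
    have h2 : ∑ i, u i * (V i * s + ∑ l, H i l * (b l - s * e l)) =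
        (∑ i, u i * V i) * s - ∑ i, u i * ∑ l, H i l * (s * e l - b l) := by
      simp only [Finset.sum_mul, ← Finset.sum_sub_distrib]
      refine Finset.sum_congr rfl fun i _ => ?_
      have : ∑ l, H i l * (b l - s * e l) = -∑ l, H i l * (s * e l - b l) := by
        rw [← Finset.sum_neg_distrib]
        exact Finset.sum_congr rfl fun l _ => by ring
      rw [this]; ring
    rw [h2, huV, zero_mul] at h1
    linarith

end Deterministic

section RowLaw

lemma rho'_pos (t : ℝ) : 0 < rho' t := by unfold rho'; positivity

lemma rho'_lt_one (t : ℝ) : rho' t < 1 := by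
  unfold rho'
  rw [div_lt_one (by positivity)]
  linarith

lemma one_sub_rho' (t : ℝ) : 1 - rho' t = rho' (-t) := by
  unfold rho'
  rw [Real.exp_neg]
  field_simp
  ring

lemma continuous_rho' : Continuous rho' := by
  unfold rho'
  exact Real.continuous_exp.div (continuous_const.add Real.continuous_exp) fun t =>
    (add_pos one_pos (Real.exp_pos t)).ne'

lemma measurable_rho' : Measurable rho' := continuous_rho'.measurable

instance isProbabilityMeasure_unif : IsProbabilityMeasure unif := by
  unfold unif
  exact ⟨by simp⟩

lemma unif_Iic {a : ℝ} (h1 : a ≤ 1) : unif (Set.Iic a) = ENNReal.ofReal a := by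
  unfold unif
  rw [Measure.restrict_apply measurableSet_Iic]
  have : Set.Iic a ∩ Set.Icc 0 1 = Set.Icc 0 a := by
    ext x
    simp only [Set.mem_inter_iff, Set.mem_Iic, Set.mem_Icc]
    exact ⟨fun h => ⟨h.2.1, h.1⟩, fun h => ⟨h.2, h.1, h.2.trans h1⟩⟩
  rw [this, Real.volume_Icc, sub_zero]

lemma unif_Ioi {a : ℝ} (h0 : 0 ≤ a) (h1 : a ≤ 1) :
    unif (Set.Ioi a) = ENNReal.ofReal (1 - a) := by
  rw [← Set.compl_Iic, prob_compl_eq_one_sub measurableSet_Iic, unif_Iic h1,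
    ENNReal.ofReal_sub _ h0, ENNReal.ofReal_one]

/-- Flipping the sign of a symmetric vector according to a logistic response biases its law by
the density `2ρ'`. -/
lemma measurePreserving_sign_flip {E : Type*} [MeasurableSpace E] [Neg E] [MeasurableNeg E]
    {μ : Measure E} [IsProbabilityMeasure μ] (hμ : MeasurePreserving (fun x : E => -x) μ μ)
    {t : E → ℝ} (ht : Measurable t) (hodd : ∀ x, t (-x) = -t x) :
    MeasurePreserving (fun z : E × ℝ => if z.2 ≤ rho' (t z.1) then z.1 else -z.1)
      (μ.prod unif) (μ.withDensity fun x => ENNReal.ofReal (2 * rho' (t x))) := by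
  have hr : Measurable fun x => rho' (t x) := measurable_rho'.comp ht
  have hset : MeasurableSet {z : E × ℝ | z.2 ≤ rho' (t z.1)} :=
    measurableSet_le measurable_snd (hr.comp measurable_fst)
  have hmeas : Measurable (fun z : E × ℝ => if z.2 ≤ rho' (t z.1) then z.1 else -z.1) :=
    Measurable.ite hset measurable_fst measurable_fst.neg
  refine ⟨hmeas, Measure.ext fun s hs => ?_⟩
  rw [Measure.map_apply hmeas hs, Measure.prod_apply (hmeas hs), withDensity_apply _ hs]
  have hfib : ∀ x : E, unif (Prod.mk x ⁻¹'
      ((fun z : E × ℝ => if z.2 ≤ rho' (t z.1) then z.1 else -z.1) ⁻¹' s)) =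
      s.indicator (fun x => ENNReal.ofReal (rho' (t x))) x +
        s.indicator (fun x => ENNReal.ofReal (rho' (t x))) (-x) := by
    intro x
    have h0 := (rho'_pos (t x)).le
    have h1 := (rho'_lt_one (t x)).le
    have hset' : Prod.mk x ⁻¹'
        ((fun z : E × ℝ => if z.2 ≤ rho' (t z.1) then z.1 else -z.1) ⁻¹' s) =
        ({u | x ∈ s} ∩ Set.Iic (rho' (t x))) ∪ ({u | -x ∈ s} ∩ Set.Ioi (rho' (t x))) := by
      ext u
      simp only [Set.mem_preimage, Set.mem_union, Set.mem_inter_iff, Set.mem_ofPred_eq,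
        Set.mem_Iic, Set.mem_Ioi]
      by_cases hu : u ≤ rho' (t x)
      · simp [hu]
      · simp [hu, not_le.1 hu]
    rw [hset', measure_union]
    · congr 1
      · by_cases hx : x ∈ s
        · simp [hx, unif_Iic h1]
        · simp [hx]
      · by_cases hx : -x ∈ s
        · simp [hx, unif_Ioi h0 h1, hodd, one_sub_rho']
        · simp [hx]
    · refine Disjoint.mono Set.inter_subset_right Set.inter_subset_right ?_
      exact Set.Iic_disjoint_Ioi le_rfl
    · exact (MeasurableSet.const _).inter measurableSet_Ioi
  have hind : Measurable (s.indicator fun x => ENNReal.ofReal (rho' (t x))) :=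
    hr.ennreal_ofReal.indicator hs
  rw [lintegral_congr hfib, lintegral_add_left hind, hμ.lintegral_comp hind, ← two_mul,
    lintegral_indicator hs, ← lintegral_const_mul _ hr.ennreal_ofReal]
  refine lintegral_congr fun x => ?_
  rw [ENNReal.ofReal_mul zero_le_two, ENNReal.ofReal_ofNat]

lemma measurePreserving_neg_gauss : MeasurePreserving (fun x : ℝ => -x) gauss gauss := by
  refine ⟨measurable_neg, ?_⟩
  unfold gauss
  rw [gaussianReal_map_neg, neg_zero]

lemma measurePreserving_neg_gaussPi (ι : Type*) [Fintype ι] :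
    MeasurePreserving (fun x : ι → ℝ => -x) (gaussPi ι) (gaussPi ι) :=
  measurePreserving_pi (fun _ : ι => gauss) (fun _ => gauss) fun _ => measurePreserving_neg_gauss

/-- The law with density `2ρ'(γ·)φ(·)`. -/
def tiltedGauss (γ : ℝ) : Measure ℝ :=
  gauss.withDensity fun v => ENNReal.ofReal (2 * rho' (γ * v))

instance isProbabilityMeasure_tiltedGauss (γ : ℝ) : IsProbabilityMeasure (tiltedGauss γ) := by
  have h := measurePreserving_sign_flip measurePreserving_neg_gauss (t := fun v => γ * v)
    (by fun_prop) (by intro x; ring)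
  rw [tiltedGauss, ← h.map_eq]
  exact Measure.isProbabilityMeasure_map h.aemeasurable

instance nullSingletonClass_tiltedGauss (γ : ℝ) : NullSingletonClass (tiltedGauss γ) := by
  have : NullSingletonClass gauss := nullSingletonClass_gaussianReal one_ne_zero
  exact ⟨fun x => withDensity_absolutelyContinuous _ _ (measure_singleton x)⟩

lemma charFunDual_gauss (L : StrongDual ℝ ℝ) :
    charFunDual gauss L = Complex.exp (-((L 1 : ℝ) ^ 2 : ℝ) / 2) := by
  have h : ∀ v : ℝ, L v = L 1 * v := fun v => by
    rw [mul_comm, ← smul_eq_mul, ← map_smul, smul_eq_mul, mul_one]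
  have h2 : charFunDual gauss L = charFun gauss (L 1) := by
    rw [charFunDual_apply, charFun_apply_real]
    refine integral_congr_ae (.of_forall fun v => ?_)
    simp only [h v]
    push_cast
    ring_nf
  rw [h2]
  unfold gauss
  rw [charFun_gaussianReal]
  push_cast
  congr 1
  simp
  ring

lemma charFunDual_gaussPi {ι : Type*} [Fintype ι] [DecidableEq ι] (L : StrongDual ℝ (ι → ℝ)) :
    charFunDual (gaussPi ι) L =
      Complex.exp (-((∑ i, L (Pi.single i 1) ^ 2 : ℝ)) / 2) := by
  unfold gaussPi
  rw [charFunDual_pi]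
  simp only [charFunDual_gauss, ← Complex.exp_sum]
  congr 1
  push_cast
  rw [← Finset.sum_div, Finset.sum_neg_distrib]
  simp

/-- Resampling the component of a standard Gaussian vector along a unit vector `e` leaves its law
unchanged. -/
lemma measurePreserving_resample {ι : Type*} [Fintype ι] {e : ι → ℝ} (he : ∑ i, e i ^ 2 = 1) :
    MeasurePreserving (fun (z : ℝ × (ι → ℝ)) l =>
        z.1 * e l + (z.2 l - (∑ m, e m * z.2 m) * e l))
      (gauss.prod (gaussPi ι)) (gaussPi ι) := by
  classical
  let Φ : ℝ × (ι → ℝ) →L[ℝ] (ι → ℝ) := ⟨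
    { toFun := fun z l => z.1 * e l + (z.2 l - (∑ m, e m * z.2 m) * e l)
      map_add' := fun z w => by
        ext l
        simp only [Prod.fst_add, Prod.snd_add, Pi.add_apply, mul_add, Finset.sum_add_distrib]
        ring
      map_smul' := fun r z => by
        have : ∑ m, e m * (r * z.2 m) = r * ∑ m, e m * z.2 m := by
          rw [Finset.mul_sum]
          exact Finset.sum_congr rfl fun _ _ => by ring
        ext l
        simp only [Prod.smul_fst, Prod.smul_snd, Pi.smul_apply, smul_eq_mul, RingHom.id_apply,
          this]
        ring }, by fun_prop⟩
  have hΦ : ∀ z, Φ z = fun l => z.1 * e l + (z.2 l - (∑ m, e m * z.2 m) * e l) := fun _ => rfl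
  refine ⟨by fun_prop, ?_⟩
  change Measure.map Φ _ = _
  have : IsFiniteMeasure (Measure.map Φ (gauss.prod (gaussPi ι))) := inferInstance
  refine Measure.ext_of_charFunDual (funext fun L => ?_)
  have hL : ∀ x : ι → ℝ, L x = ∑ i, x i * L (Pi.single i 1) := by
    intro x
    conv_lhs => rw [pi_eq_sum_univ' x]
    rw [map_sum]
    refine Finset.sum_congr rfl fun i _ => ?_
    rw [map_smul, smul_eq_mul]
  rw [charFunDual_map, charFunDual_prod, charFunDual_gauss, charFunDual_gaussPi,
    charFunDual_gaussPi, ← Complex.exp_add]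
  congr 1
  set a : ι → ℝ := fun i => L (Pi.single i 1) with ha
  set s := ∑ i, e i * a i with hs
  have h1 : L (Φ (1, 0)) = s := by
    rw [hL, hΦ]
    simp [hs, ha]
  have h2 : ∀ i, L (Φ (0, Pi.single i 1)) = a i - e i * s := by
    intro i
    rw [hΦ, hL]
    simp only [zero_mul, zero_add, sub_mul, Finset.sum_sub_distrib]
    simp only [Pi.single_apply, mul_ite, mul_one, mul_zero, Finset.sum_ite_eq',
      Finset.mem_univ, if_true, ite_mul, one_mul, zero_mul, hs,
      Finset.mul_sum, mul_assoc, ha]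
  simp only [ContinuousLinearMap.comp_apply, ContinuousLinearMap.inl_apply,
    ContinuousLinearMap.inr_apply, h1, h2]
  rw [← add_div, ← neg_add, ← Complex.ofReal_add]
  congr 3
  have h3 : ∑ i, (a i - e i * s) ^ 2 = ∑ i, a i ^ 2 - 2 * s * s + s ^ 2 * ∑ i, e i ^ 2 := by
    conv_rhs => rw [show 2 * s * s = 2 * s * ∑ i, e i * a i by rw [← hs]]
    simp only [Finset.mul_sum, ← Finset.sum_sub_distrib, ← Finset.sum_add_distrib]
    exact Finset.sum_congr rfl fun i _ => by ring
  rw [h3, he]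
  ring

lemma measurePreserving_resample_tilted {ι : Type*} [Fintype ι] {e : ι → ℝ}
    (he : ∑ i, e i ^ 2 = 1) (γ : ℝ) :
    MeasurePreserving (fun (z : ℝ × (ι → ℝ)) l =>
        z.1 * e l + (z.2 l - (∑ m, e m * z.2 m) * e l))
      ((tiltedGauss γ).prod (gaussPi ι))
      ((gaussPi ι).withDensity fun x => ENNReal.ofReal (2 * rho' (γ * ∑ i, e i * x i))) := by
  have hΦ := measurePreserving_resample he
  have hf : Measurable fun x : ι → ℝ => ENNReal.ofReal (2 * rho' (γ * ∑ i, e i * x i)) :=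
    ((measurable_rho'.comp (by fun_prop)).const_mul 2).ennreal_ofReal
  refine ⟨hΦ.measurable, Measure.ext fun s hs => ?_⟩
  have hg : Measurable fun v : ℝ => ENNReal.ofReal (2 * rho' (γ * v)) :=
    ((measurable_rho'.comp (by fun_prop)).const_mul 2).ennreal_ofReal
  rw [Measure.map_apply hΦ.measurable hs, withDensity_apply _ hs, tiltedGauss,
    prod_withDensity_left hg, withDensity_apply _ (hΦ.measurable hs),
    ← hΦ.setLIntegral_comp_preimage hs hf]
  refine lintegral_congr fun z => ?_
  congr 4
  have : ∑ i, e i * (z.1 * e i + (z.2 i - (∑ m, e m * z.2 m) * e i)) =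
      z.1 * ∑ i, e i ^ 2 + ∑ m, e m * z.2 m - (∑ m, e m * z.2 m) * ∑ i, e i ^ 2 := by
    rw [Finset.mul_sum, Finset.mul_sum, ← Finset.sum_add_distrib, ← Finset.sum_sub_distrib]
    exact Finset.sum_congr rfl fun i _ => by ring
  rw [this, he]
  ring

lemma measurePreserving_scale_gauss {n : ℕ} (hn : 0 < n) :
    MeasurePreserving (fun x : ℝ => Real.sqrt n * x) (gaussianReal 0 (n : ℝ≥0)⁻¹) gauss := by
  refine ⟨by fun_prop, ?_⟩
  rw [gaussianReal_map_const_mul, mul_zero, gauss]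
  congr 1
  have h : (n : ℝ≥0) ≠ 0 := Nat.cast_ne_zero.2 hn.ne'
  rw [← mul_inv_cancel₀ h]
  congr 1
  ext
  simp

end RowLaw

section DesignLaw

/-- Matrices whose rows lie in a common closed half-space. -/
def separatedSet (n p : ℕ) : Set (Fin n → Fin p → ℝ) :=
  {W | ∃ b : Fin p → ℝ, b ≠ 0 ∧ ∀ i, 0 ≤ ∑ l, W i l * b l}

lemma isClosed_separatedSet (n p : ℕ) : IsClosed (separatedSet n p) := by
  let K : Set (Metric.sphere (0 : Fin p → ℝ) 1 × (Fin n → Fin p → ℝ)) :=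
    {z | ∀ i, 0 ≤ ∑ l, z.2 i l * (z.1 : Fin p → ℝ) l}
  have hK : IsClosed K := by
    simp only [K, Set.ofPred_forall]
    refine isClosed_iInter fun i => isClosed_le continuous_const ?_
    exact continuous_finsetSum _ fun l _ => ((continuous_apply l).comp
      ((continuous_apply i).comp continuous_snd)).mul
        ((continuous_apply l).comp (continuous_subtype_val.comp continuous_fst))
  convert isClosedMap_snd_of_compactSpace _ hK
  ext W
  constructor
  · rintro ⟨b, hb, h⟩
    have hnb : 0 < ‖b‖ := norm_pos_iff.2 hb
    refine ⟨(⟨‖b‖⁻¹ • b, ?_⟩, W), fun i => ?_, rfl⟩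
    · rw [mem_sphere_zero_iff_norm, norm_smul, norm_inv, norm_norm, inv_mul_cancel₀ hnb.ne']
    · have : ∑ l, W i l * (‖b‖⁻¹ • b) l = ‖b‖⁻¹ * ∑ l, W i l * b l := by
        rw [Finset.mul_sum]
        exact Finset.sum_congr rfl fun l _ => by simp only [Pi.smul_apply, smul_eq_mul]; ring
      simp only [this]
      exact mul_nonneg (inv_nonneg.2 hnb.le) (h i)
  · rintro ⟨⟨b, W'⟩, h, rfl⟩
    exact ⟨b, ne_zero_of_mem_unit_sphere b, h⟩

variable {n p : ℕ} {e : Fin p → ℝ} {γ : ℝ}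

lemma designLaw_separated_le_tilted (hn : 0 < n) (he : ∑ j, e j ^ 2 = 1) {β : Fin p → ℝ}
    (hβ : ∀ j, β j = Real.sqrt n * γ * e j) :
    designLaw n p {Z | ∃ b : Fin p → ℝ, b ≠ 0 ∧
        ∀ i, 0 ≤ (2 * resp Z.1 Z.2 β i - 1) * ∑ j, Z.1 i j * b j} ≤
      ((Measure.pi fun _ : Fin n => tiltedGauss γ).prod
          (Measure.pi fun _ : Fin n => gaussPi (Fin p)))
        {z | (fun i l => z.1 i * e l + (z.2 i l - (∑ m, e m * z.2 i m) * e l)) ∈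
          separatedSet n p} := by
  have hsn : 0 < Real.sqrt n := Real.sqrt_pos.2 (Nat.cast_pos.2 hn)
  have hscale : MeasurePreserving (fun (x : Fin p → ℝ) j => Real.sqrt n * x j)
      (Measure.pi fun _ : Fin p => gaussianReal 0 (n : ℝ≥0)⁻¹) (gaussPi (Fin p)) :=
    measurePreserving_pi _ _ fun _ => measurePreserving_scale_gauss hn
  have hflip := measurePreserving_sign_flip (measurePreserving_neg_gaussPi (Fin p))
    (t := fun x => γ * ∑ i, e i * x i) (by fun_prop) (by intro x; simp)
  have hres := measurePreserving_resample_tilted he γ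
  have hprob : IsProbabilityMeasure ((gaussPi (Fin p)).withDensity
      fun x => ENNReal.ofReal (2 * rho' (γ * ∑ i, e i * x i))) := by
    rw [← hflip.map_eq]
    exact Measure.isProbabilityMeasure_map hflip.aemeasurable
  have hrow := measurePreserving_pi (fun _ : Fin n => _) (fun _ => _)
    fun _ => hflip.comp (hscale.prod (MeasurePreserving.id unif))
  have hdes := hrow.comp (measurePreserving_arrowProdEquivProdArrow (Fin p → ℝ) ℝ (Fin n)
    (fun _ => Measure.pi fun _ : Fin p => gaussianReal 0 (n : ℝ≥0)⁻¹) (fun _ => unif)).symm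
  have htil := (measurePreserving_pi (fun _ : Fin n => _) (fun _ => _) fun _ => hres).comp
    (measurePreserving_arrowProdEquivProdArrow ℝ (Fin p → ℝ) (Fin n)
    (fun _ => tiltedGauss γ) (fun _ => gaussPi (Fin p))).symm
  have hmeas : MeasurableSet (separatedSet n p) := (isClosed_separatedSet n p).measurableSet
  have h2 := htil.measure_preimage hmeas.nullMeasurableSet
  have h1 := hdes.measure_preimage_le (separatedSet n p)
  rw [← h2] at h1
  refine le_trans (measure_mono ?_) h1
  rintro ⟨X, U⟩ ⟨b, hb, h⟩
  refine ⟨b, hb, fun i => ?_⟩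
  have hdot : γ * ∑ j, e j * (Real.sqrt n * X i j) = ∑ j, X i j * β j := by
    rw [Finset.mul_sum]
    exact Finset.sum_congr rfl fun j _ => by rw [hβ]; ring
  have hlin : ∑ j, (Real.sqrt n * X i j) * b j = Real.sqrt n * ∑ j, X i j * b j := by
    rw [Finset.mul_sum]
    exact Finset.sum_congr rfl fun j _ => by ring
  have hi := h i
  change 0 ≤ ∑ l, (if U i ≤ rho' (γ * ∑ j, e j * (Real.sqrt n * X i j)) then
    (fun j => Real.sqrt n * X i j) else -(fun j => Real.sqrt n * X i j)) l * b l
  rw [hdot]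
  simp only [resp] at hi
  split_ifs at hi ⊢ with hu
  · rw [hlin]
    exact mul_nonneg hsn.le (by linarith)
  · simp only [Pi.neg_apply, neg_mul, Finset.sum_neg_distrib]
    rw [hlin, ← mul_neg]
    exact mul_nonneg hsn.le (by linarith)

theorem designLaw_separated_le (hn : 0 < n) (he : ∑ j, e j ^ 2 = 1) {β : Fin p → ℝ}
    (hβ : ∀ j, β j = Real.sqrt n * γ * e j) {c r : ℝ} (hc : 0 < c) (hr : 0 ≤ r)
    {B : Set ((Fin n → ℝ) × (Fin n → ℝ))} (hB : MeasurableSet B)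
    (hBV : ∀ V g, (V, g) ∉ B → ∃ u ∈ conicSphere V, r + 2 * c < ∑ i, u i * g i) :
    designLaw n p {Z | ∃ b : Fin p → ℝ, b ≠ 0 ∧
        ∀ i, 0 ≤ (2 * resp Z.1 Z.2 β i - 1) * ∑ j, Z.1 i j * b j} ≤
      gauss {x | c ≤ x} + gaussPi (Fin p) {h | r ^ 2 ≤ ∑ l, h l ^ 2} +
        ((Measure.pi fun _ : Fin n => tiltedGauss γ).prod (gaussPi (Fin n))) B := by
  refine (designLaw_separated_le_tilted hn he hβ).trans ?_
  have hΨ : Measurable fun (z : (Fin n → ℝ) × (Fin n → Fin p → ℝ)) (i : Fin n) (l : Fin p) =>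
      z.1 i * e l + (z.2 i l - (∑ m, e m * z.2 i m) * e l) := by fun_prop
  have hS : MeasurableSet {z : (Fin n → ℝ) × (Fin n → Fin p → ℝ) |
      (fun i l => z.1 i * e l + (z.2 i l - (∑ m, e m * z.2 i m) * e l)) ∈ separatedSet n p} :=
    hΨ (isClosed_separatedSet n p).measurableSet
  rw [Measure.prod_apply hS, Measure.prod_apply hB]
  have hV : ∀ᵐ V ∂(Measure.pi fun _ : Fin n => tiltedGauss γ), ∀ i, V i ≠ 0 :=
    ae_all_iff.2 fun i => Measure.ae_eval_ne (fun _ : Fin n => tiltedGauss γ) i 0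
  calc _ ≤ ∫⁻ V, (gauss {x | c ≤ x} + gaussPi (Fin p) {h | r ^ 2 ≤ ∑ l, h l ^ 2} +
        gaussPi (Fin n) (Prod.mk V ⁻¹' B)) ∂(Measure.pi fun _ : Fin n => tiltedGauss γ) := by
        refine lintegral_mono_ae ?_
        filter_upwards [hV] with V hV
        refine le_trans (measure_mono ?_) ((measure_escape_le (p := p) (conicSphere V)
          (fun u hu => hu.2.2) hc hr).trans (add_le_add le_rfl (measure_mono ?_)))
        · rintro H ⟨b, hb, h⟩
          exact not_escape_of_separated hV H e b hb h
        · intro g hg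
          by_contra h
          exact hg (hBV V g h)
    _ = _ := by
        rw [lintegral_add_left measurable_const, lintegral_const, measure_univ, mul_one]

end DesignLaw

section WeakLaw

/-- A weak law of large numbers for triangular arrays. -/
theorem tendsto_measure_deviation {E : Type*} [MeasurableSpace E] (τ : ℕ → Measure E)
    [∀ n, IsProbabilityMeasure (τ n)] {f : E → ℝ} (hf : ∀ n, MemLp f 2 (τ n)) {C : ℝ}
    (hC : ∀ n, ∫ x, f x ^ 2 ∂τ n ≤ C) {m : ℝ}
    (hm : Tendsto (fun n => ∫ x, f x ∂τ n) atTop (𝓝 m)) {k : ℕ → ℕ}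
    (hk : Tendsto k atTop atTop) {ε : ℝ} (hε : 0 < ε) :
    Tendsto (fun n => (Measure.pi fun _ : Fin (k n) => τ n)
      {x | ε * k n ≤ |∑ i, f (x i) - m * k n|}) atTop (𝓝 0) := by
  have hbound : ∀ᶠ n in atTop, (Measure.pi fun _ : Fin (k n) => τ n)
      {x | ε * k n ≤ |∑ i, f (x i) - m * k n|} ≤
        ENNReal.ofReal (C / (ε / 2) ^ 2 * (k n : ℝ)⁻¹) := by
    filter_upwards [(Metric.tendsto_nhds.1 hm) (ε / 2) (half_pos hε), hk.eventually_gt_atTop 0]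
      with n hn hkn
    have hk0 : (0 : ℝ) < k n := Nat.cast_pos.2 hkn
    have hLp : MemLp (fun x : Fin (k n) → E => ∑ i, f (x i)) 2
        (Measure.pi fun _ : Fin (k n) => τ n) :=
      memLp_finsetSum _ fun i _ => (hf n).comp_measurePreserving
        (measurePreserving_eval (fun _ : Fin (k n) => τ n) i)
    have hmean : ∫ x, ∑ i, f (x i) ∂(Measure.pi fun _ : Fin (k n) => τ n) =
        k n * ∫ x, f x ∂τ n := by
      rw [integral_finsetSum _ fun i _ => integrable_comp_eval (i := i)
        (μ := fun _ : Fin (k n) => τ n) ((hf n).integrable one_le_two)]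
      have : ∀ i : Fin (k n), ∫ x, f (x i) ∂(Measure.pi fun _ : Fin (k n) => τ n) =
          ∫ x, f x ∂τ n := fun i =>
        integral_comp_eval (i := i) (μ := fun _ : Fin (k n) => τ n) (hf n).aestronglyMeasurable
      simp [this]
    have hvar : Var[fun x : Fin (k n) → E => ∑ i, f (x i); Measure.pi fun _ : Fin (k n) => τ n]
        ≤ k n * C := by
      have h1 := variance_sum_pi (μ := fun _ : Fin (k n) => τ n) (X := fun _ => f)
        (fun _ => hf n)
      have h2 : (∑ i : Fin (k n), fun ω : Fin (k n) → E => f (ω i)) =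
          fun x => ∑ i, f (x i) := by ext; simp
      rw [h2] at h1
      rw [h1, Finset.sum_const, Finset.card_univ, Fintype.card_fin, nsmul_eq_mul]
      refine mul_le_mul_of_nonneg_left ?_ hk0.le
      exact (variance_le_expectation_sq (hf n).aestronglyMeasurable).trans (hC n)
    have hcheb := meas_ge_le_variance_div_sq hLp (c := ε / 2 * k n) (by positivity)
    rw [hmean] at hcheb
    refine le_trans (measure_mono fun x hx => ?_) (hcheb.trans (ENNReal.ofReal_le_ofReal ?_))
    · simp only [Set.mem_ofPred_eq] at hx ⊢
      rw [Real.dist_eq] at hn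
      have h3 : |(k n : ℝ) * ∫ x, f x ∂τ n - m * k n| ≤ ε / 2 * k n := by
        rw [mul_comm m, ← mul_sub, abs_mul, abs_of_pos hk0, mul_comm]
        exact mul_le_mul_of_nonneg_right hn.le hk0.le
      have h4 := abs_sub_le (∑ i, f (x i)) ((k n : ℝ) * ∫ x, f x ∂τ n) (m * k n)
      linarith
    · refine (div_le_div_of_nonneg_right hvar (by positivity)).trans (le_of_eq ?_)
      field_simp
  refine tendsto_of_tendsto_of_tendsto_of_le_of_le' tendsto_const_nhds ?_
    (.of_forall fun _ => zero_le) hbound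
  have h1 : Tendsto (fun n => C / (ε / 2) ^ 2 * (k n : ℝ)⁻¹) atTop
      (𝓝 (C / (ε / 2) ^ 2 * 0)) :=
    (tendsto_inv_atTop_zero.comp (tendsto_natCast_atTop_atTop.comp hk)).const_mul _
  rw [mul_zero] at h1
  simpa using ENNReal.tendsto_ofReal h1

/-- The joint law of `(V, Z)`. -/
def pairLaw (γ : ℝ) : Measure (ℝ × ℝ) := (tiltedGauss γ).prod gauss

instance isProbabilityMeasure_pairLaw (γ : ℝ) : IsProbabilityMeasure (pairLaw γ) := by
  unfold pairLaw; infer_instance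

lemma measurable_tilt (γ : ℝ) : Measurable fun v : ℝ => ENNReal.ofReal (2 * rho' (γ * v)) :=
  ((measurable_rho'.comp (by fun_prop)).const_mul 2).ennreal_ofReal

lemma measurable_tilt_fst (γ : ℝ) :
    Measurable fun z : ℝ × ℝ => ENNReal.ofReal (2 * rho' (γ * z.1)) :=
  (measurable_tilt γ).comp measurable_fst

lemma pairLaw_eq_withDensity (γ : ℝ) :
    pairLaw γ = (gauss.prod gauss).withDensity fun z => ENNReal.ofReal (2 * rho' (γ * z.1)) := by
  rw [pairLaw, tiltedGauss, prod_withDensity_left (measurable_tilt γ)]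

lemma integral_pairLaw (γ : ℝ) (f : ℝ × ℝ → ℝ) :
    ∫ z, f z ∂pairLaw γ = ∫ z, f z * (2 * rho' (γ * z.1)) ∂(gauss.prod gauss) := by
  rw [pairLaw_eq_withDensity, integral_withDensity_eq_integral_toReal_smul
    (measurable_tilt_fst γ) (.of_forall fun _ => ENNReal.ofReal_lt_top)]
  refine integral_congr_ae (.of_forall fun z => ?_)
  simp only [smul_eq_mul]
  rw [ENNReal.toReal_ofReal (by have := rho'_pos (γ * z.1); positivity), mul_comm]

lemma abs_mul_tilt_le (x s : ℝ) : |x * (2 * rho' s)| ≤ 2 * |x| := by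
  have h0 := rho'_pos s
  have h1 := rho'_lt_one s
  rw [abs_mul, abs_of_pos (by positivity : 0 < 2 * rho' s), mul_comm]
  exact mul_le_mul_of_nonneg_right (by linarith) (abs_nonneg x)

lemma integrable_mul_tilt {f : ℝ × ℝ → ℝ} (hf : Integrable f (gauss.prod gauss)) (γ : ℝ) :
    Integrable (fun z => f z * (2 * rho' (γ * z.1))) (gauss.prod gauss) := by
  refine (hf.abs.const_mul 2).mono' (hf.aestronglyMeasurable.mul ?_)
    (.of_forall fun z => abs_mul_tilt_le _ _)
  exact ((measurable_rho'.comp (by fun_prop)).const_mul 2).aestronglyMeasurable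

lemma tendsto_integral_pairLaw {f : ℝ × ℝ → ℝ} (hf : Integrable f (gauss.prod gauss))
    {g : ℕ → ℝ} {γ : ℝ} (hg : Tendsto g atTop (𝓝 γ)) :
    Tendsto (fun n => ∫ z, f z ∂pairLaw (g n)) atTop (𝓝 (∫ z, f z ∂pairLaw γ)) := by
  simp only [integral_pairLaw]
  refine tendsto_integral_filter_of_dominated_convergence (fun z => 2 * |f z|)
    (.of_forall fun n => (integrable_mul_tilt hf (g n)).aestronglyMeasurable)
    (.of_forall fun n => .of_forall fun z => abs_mul_tilt_le _ _) (hf.abs.const_mul 2)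
    (.of_forall fun z => ?_)
  exact (((continuous_rho'.tendsto _).comp (hg.mul_const z.1)).const_mul 2).const_mul (f z)

lemma memLp_pairLaw {f : ℝ × ℝ → ℝ} (hf : MemLp f 2 (gauss.prod gauss)) (γ : ℝ) :
    MemLp f 2 (pairLaw γ) := by
  have h := hf.integrable_sq
  have hac : pairLaw γ ≪ gauss.prod gauss := by
    rw [pairLaw_eq_withDensity]
    exact withDensity_absolutelyContinuous _ _
  rw [memLp_two_iff_integrable_sq (hf.aestronglyMeasurable.mono_ac hac), pairLaw_eq_withDensity,
    integrable_withDensity_iff_integrable_smul' (measurable_tilt_fst γ)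
      (.of_forall fun _ => ENNReal.ofReal_lt_top)]
  refine (integrable_mul_tilt h γ).congr (.of_forall fun z => ?_)
  simp only [smul_eq_mul]
  rw [ENNReal.toReal_ofReal (by have := rho'_pos (γ * z.1); positivity), mul_comm]

lemma integral_sq_pairLaw_le {f : ℝ × ℝ → ℝ} (hf : MemLp f 2 (gauss.prod gauss)) (γ : ℝ) :
    ∫ z, f z ^ 2 ∂pairLaw γ ≤ 2 * ∫ z, f z ^ 2 ∂(gauss.prod gauss) := by
  rw [integral_pairLaw, ← integral_const_mul]
  refine integral_mono (integrable_mul_tilt hf.integrable_sq γ) (hf.integrable_sq.const_mul 2)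
    fun z => (le_abs_self _).trans ((abs_mul_tilt_le _ _).trans (le_of_eq ?_))
  rw [abs_of_nonneg (sq_nonneg _)]

/-- Simultaneous concentration of finitely many empirical averages. -/
theorem tendsto_measure_exists_deviation {F : Set (ℝ × ℝ → ℝ)} (hF : F.Finite)
    (hLp : ∀ f ∈ F, MemLp f 2 (gauss.prod gauss)) {g : ℕ → ℝ} {γ : ℝ}
    (hg : Tendsto g atTop (𝓝 γ)) {ε : ℝ} (hε : 0 < ε) :
    Tendsto (fun n => (Measure.pi fun _ : Fin n => pairLaw (g n))
      (⋃ f ∈ F, {x | ε * n ≤ |∑ i, f (x i) - (∫ z, f z ∂pairLaw γ) * n|})) atTop (𝓝 0) := by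
  have hsum : Tendsto (fun n => ∑ f ∈ hF.toFinset, (Measure.pi fun _ : Fin n => pairLaw (g n))
      {x | ε * n ≤ |∑ i, f (x i) - (∫ z, f z ∂pairLaw γ) * n|}) atTop
      (𝓝 (∑ f ∈ hF.toFinset, 0)) := by
    refine tendsto_finsetSum _ fun f hf => ?_
    have hfF := hLp f (hF.mem_toFinset.1 hf)
    exact tendsto_measure_deviation (fun n => pairLaw (g n)) (fun n => memLp_pairLaw hfF (g n))
      (fun n => integral_sq_pairLaw_le hfF (g n))
      (tendsto_integral_pairLaw (hfF.integrable one_le_two) hg) (k := fun n => n) tendsto_id hε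
  rw [Finset.sum_const_zero] at hsum
  refine tendsto_of_tendsto_of_tendsto_of_le_of_le tendsto_const_nhds hsum
    (fun _ => zero_le) fun n => ?_
  have := measure_biUnion_finset_le (μ := Measure.pi fun _ : Fin n => pairLaw (g n)) hF.toFinset
    (fun f => {x | ε * n ≤ |∑ i, f (x i) - (∫ z, f z ∂pairLaw γ) * n|})
  simpa only [Set.Finite.mem_toFinset] using this

end WeakLaw

section UniformLowerBound

instance isOpenPosMeasure_gauss : gauss.IsOpenPosMeasure :=
  (gaussianReal_absolutelyContinuous' 0 one_ne_zero).isOpenPosMeasure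

lemma memLp_sq_gauss : MemLp (fun x : ℝ => x ^ 2) 2 gauss := by
  rw [memLp_two_iff_integrable_sq (by fun_prop)]
  exact (integrable_pow_gauss 4).congr (.of_forall fun x => by ring)

lemma memLp_of_abs_le_sq {f : ℝ × ℝ → ℝ} (hf : Measurable f) {C : ℝ}
    (h : ∀ z, |f z| ≤ C * (z.1 ^ 2 + z.2 ^ 2)) : MemLp f 2 (gauss.prod gauss) := by
  have h1 : MemLp (fun z : ℝ × ℝ => z.1 ^ 2) 2 (gauss.prod gauss) :=
    memLp_sq_gauss.comp_measurePreserving measurePreserving_fst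
  have h2 : MemLp (fun z : ℝ × ℝ => z.2 ^ 2) 2 (gauss.prod gauss) :=
    memLp_sq_gauss.comp_measurePreserving measurePreserving_snd
  refine ((h1.add h2).const_mul C).mono hf.aestronglyMeasurable (.of_forall fun z => ?_)
  exact (h z).trans (le_abs_self _)

/-- The integrand `(Z - tV)₊²` at `z = (V, Z)`. -/
def residualSq (t : ℝ) (z : ℝ × ℝ) : ℝ := max (z.2 - t * z.1) 0 ^ 2

/-- A lower bound for `(Z + tV)₊² / t²`, uniform over `t` having the same sign as `σ = ±1`. -/
def sideSq (σ : ℝ) (z : ℝ × ℝ) : ℝ := if 0 ≤ z.2 then max (σ * z.1) 0 ^ 2 else 0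

lemma max_sq_le_sq (x : ℝ) : max x 0 ^ 2 ≤ x ^ 2 := by
  rcases le_total x 0 with h | h
  · simpa [max_eq_right h] using sq_nonneg x
  · rw [max_eq_left h]

lemma measurable_residualSq (t : ℝ) : Measurable (residualSq t) := by
  unfold residualSq; fun_prop

lemma measurable_sideSq (σ : ℝ) : Measurable (sideSq σ) :=
  Measurable.ite (measurableSet_le measurable_const measurable_snd) (by fun_prop)
    measurable_const

lemma sideSq_nonneg (σ : ℝ) (z : ℝ × ℝ) : 0 ≤ sideSq σ z := by
  unfold sideSq; split_ifs <;> positivity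

lemma memLp_residualSq (t : ℝ) : MemLp (residualSq t) 2 (gauss.prod gauss) := by
  refine memLp_of_abs_le_sq (measurable_residualSq t) (C := 2 * (1 + t ^ 2)) fun z => ?_
  rw [residualSq, abs_of_nonneg (sq_nonneg _)]
  refine (max_sq_le_sq _).trans ?_
  nlinarith [sq_nonneg (z.2 + t * z.1), sq_nonneg (t * z.2), sq_nonneg z.1]

lemma memLp_sideSq (σ : ℝ) : MemLp (sideSq σ) 2 (gauss.prod gauss) := by
  refine memLp_of_abs_le_sq (measurable_sideSq σ) (C := σ ^ 2) fun z => ?_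
  rw [abs_of_nonneg (sideSq_nonneg σ z), sideSq]
  split_ifs
  · refine (max_sq_le_sq _).trans ?_
    nlinarith [sq_nonneg (σ * z.2)]
  · positivity

lemma integral_sideSq_pos {σ : ℝ} (hσ : σ ≠ 0) (γ : ℝ) :
    0 < ∫ z, sideSq σ z ∂pairLaw γ := by
  rw [integral_pairLaw, integral_pos_iff_support_of_nonneg
    (fun z => mul_nonneg (sideSq_nonneg σ z) (by have := rho'_pos (γ * z.1); positivity))
    (integrable_mul_tilt ((memLp_sideSq σ).integrable one_le_two) γ)]
  let O : Set (ℝ × ℝ) := {z | 0 < σ * z.1 ∧ 0 < z.2}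
  have hO : IsOpen O :=
    (isOpen_lt continuous_const (continuous_const.mul continuous_fst)).inter
      (isOpen_lt continuous_const continuous_snd)
  have hne : O.Nonempty := ⟨(σ, 1), mul_self_pos.2 hσ, one_pos⟩
  refine (hO.measure_pos (gauss.prod gauss) hne).trans_le (measure_mono fun z hz => ?_)
  have h1 := rho'_pos (γ * z.1)
  have h2 : 0 < σ * z.1 := hz.1
  rw [Function.mem_support, sideSq, if_pos hz.2.le, max_eq_left h2.le]
  positivity

lemma gMLEinv_le_integral_residualSq (γ t : ℝ) :
    gMLEinv γ ≤ ∫ z, residualSq t z ∂pairLaw γ := by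
  rw [integral_pairLaw, integral_prod_symm _
    (integrable_mul_tilt ((memLp_residualSq t).integrable one_le_two) γ)]
  refine ciInf_le ⟨0, ?_⟩ t
  rintro _ ⟨s, rfl⟩
  refine integral_nonneg fun z => integral_nonneg fun v => ?_
  have := rho'_pos (γ * v)
  dsimp only [Pi.zero_apply]
  positivity

lemma residualSq_le {s t η M : ℝ} (hst : |t - s| ≤ η) (hη : η ≤ 1) (ht : |t| ≤ M) (z : ℝ × ℝ) :
    residualSq s z ≤ residualSq t z + η * (z.2 ^ 2 + (2 * M + 2) * z.1 ^ 2) := by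
  have hη0 : 0 ≤ η := (abs_nonneg _).trans hst
  have h := max_add_sq_le (z.2 - t * z.1) ((t - s) * z.1)
  rw [show z.2 - t * z.1 + (t - s) * z.1 = z.2 - s * z.1 by ring] at h
  have h1 : max (z.2 - t * z.1) 0 ≤ |z.2| + M * |z.1| := by
    refine max_le ?_ (add_nonneg (abs_nonneg _)
      (mul_nonneg ((abs_nonneg _).trans ht) (abs_nonneg _)))
    have h2 := abs_sub z.2 (t * z.1)
    rw [abs_mul] at h2
    linarith [le_abs_self (z.2 - t * z.1), mul_le_mul_of_nonneg_right ht (abs_nonneg z.1)]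
  have h3 : (t - s) * z.1 ≤ η * |z.1| := by
    refine (le_abs_self _).trans ?_
    rw [abs_mul]
    exact mul_le_mul_of_nonneg_right hst (abs_nonneg _)
  have h4 : max (z.2 - t * z.1) 0 * ((t - s) * z.1) ≤ (|z.2| + M * |z.1|) * (η * |z.1|) :=
    (mul_le_mul_of_nonneg_left h3 (le_max_right _ _)).trans
      (mul_le_mul_of_nonneg_right h1 (by positivity))
  have h5 : ((t - s) * z.1) ^ 2 ≤ η * z.1 ^ 2 := by
    rw [mul_pow, ← sq_abs (t - s)]
    refine mul_le_mul_of_nonneg_right ?_ (sq_nonneg _)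
    nlinarith [abs_nonneg (t - s)]
  have h6 : 2 * |z.2| * |z.1| ≤ z.2 ^ 2 + z.1 ^ 2 := by
    nlinarith [sq_nonneg (|z.2| - |z.1|), sq_abs z.1, sq_abs z.2]
  have h7 := mul_le_mul_of_nonneg_left h6 hη0
  have h8 : (|z.2| + M * |z.1|) * (η * |z.1|) = η * (|z.2| * |z.1|) + M * η * z.1 ^ 2 := by
    rw [← sq_abs z.1]; ring
  unfold residualSq
  linarith

lemma sq_mul_sideSq_le {σ t M : ℝ} (hM : 0 ≤ M) (ht : M ≤ -(σ * t)) (hσ : σ ^ 2 = 1)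
    (z : ℝ × ℝ) : M ^ 2 * sideSq σ z ≤ residualSq t z := by
  unfold sideSq residualSq
  split_ifs with h
  · rw [← mul_pow]
    refine pow_le_pow_left₀ (mul_nonneg hM (le_max_right _ _)) ?_ 2
    rcases le_total (σ * z.1) 0 with h0 | h0
    · rw [max_eq_right h0, mul_zero]
      exact le_max_right _ _
    · rw [max_eq_left h0]
      refine le_max_of_le_left ?_
      have h1 : -(t * z.1) = -(σ * t) * (σ * z.1) := by
        linear_combination (t * z.1) * hσ
      have h2 := mul_le_mul_of_nonneg_right ht h0
      linarith
  · rw [mul_zero]; positivity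

lemma exists_pos_of_sum_sideSq_pos {n : ℕ} {σ : ℝ} {V g : Fin n → ℝ}
    (h : 0 < ∑ i, sideSq σ (V i, g i)) : ∃ i, 0 < σ * V i := by
  by_contra! hcon
  refine h.ne' (Finset.sum_eq_zero fun i _ => ?_)
  simp [sideSq, max_eq_right (hcon i)]

/-- Finitely many empirical averages control `t ↦ ∑ᵢ (gᵢ - t Vᵢ)₊²` uniformly in `t`. -/
theorem exists_finite_test_functions {γ K : ℝ} (hK : K < gMLEinv γ) :
    ∃ (F : Set (ℝ × ℝ → ℝ)) (ε : ℝ), F.Finite ∧ 0 < ε ∧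
      (∀ f ∈ F, Measurable f ∧ MemLp f 2 (gauss.prod gauss)) ∧
      ∀ n : ℕ, 0 < n → ∀ V g : Fin n → ℝ,
        (∀ f ∈ F, |∑ i, f (V i, g i) - (∫ z, f z ∂pairLaw γ) * n| < ε * n) →
        (∃ i, V i < 0) ∧ (∃ i, 0 < V i) ∧ ∀ t, K * n < ∑ i, max (g i - t * V i) 0 ^ 2 := by
  have hpos := integral_sideSq_pos one_ne_zero γ
  have hneg := integral_sideSq_pos (neg_ne_zero.2 one_ne_zero) γ
  set a := ∫ z, sideSq 1 z ∂pairLaw γ with ha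
  set b := ∫ z, sideSq (-1) z ∂pairLaw γ with hb
  set M := 1 + 2 * |K| / a + 2 * |K| / b with hM
  have hM1 : 1 ≤ M := by rw [hM, add_assoc]; exact le_add_of_nonneg_right (by positivity)
  have hMa : K < M ^ 2 * (a / 2) := by
    have : M * (a / 2) = a / 2 + |K| + |K| / b * a := by rw [hM]; field_simp
    have h2 : 0 ≤ |K| / b * a := by positivity
    nlinarith [le_abs_self K, mul_le_mul_of_nonneg_right hM1 (by positivity : 0 ≤ M * (a / 2))]
  have hMb : K < M ^ 2 * (b / 2) := by
    have : M * (b / 2) = b / 2 + |K| + |K| / a * b := by rw [hM]; field_simp; ring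
    have h2 : 0 ≤ |K| / a * b := by positivity
    nlinarith [le_abs_self K, mul_le_mul_of_nonneg_right hM1 (by positivity : 0 ≤ M * (b / 2))]
  let f : ℝ × ℝ → ℝ := fun z => z.2 ^ 2 + (2 * M + 2) * z.1 ^ 2
  have hfm : Measurable f := by fun_prop
  have hfLp : MemLp f 2 (gauss.prod gauss) := by
    refine memLp_of_abs_le_sq hfm (C := 2 * M + 2) fun z => ?_
    rw [abs_of_nonneg (by positivity)]
    simp only [f]
    nlinarith [sq_nonneg z.2]
  set m := ∫ z, f z ∂pairLaw γ with hm
  have hm0 : 0 ≤ m := integral_nonneg fun z => by simp only [f, Pi.zero_apply]; positivity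
  obtain ⟨d, hd, hdK⟩ : ∃ d, 0 < d ∧ K + 2 * d = gMLEinv γ :=
    ⟨(gMLEinv γ - K) / 2, by linarith, by ring⟩
  obtain ⟨η, hη, hη1, hηd⟩ : ∃ η, 0 < η ∧ η ≤ 1 ∧ η * (m + 1) ≤ d / 2 := by
    refine ⟨min 1 (d / 2 / (m + 1)), by positivity, min_le_left _ _, ?_⟩
    exact (mul_le_mul_of_nonneg_right (min_le_right _ _) (by positivity)).trans_eq
      (div_mul_cancel₀ _ (by positivity))
  obtain ⟨S, -, hSfin, hS⟩ := (isCompact_Icc (a := -M) (b := M)).finite_cover_balls hη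
  refine ⟨{f, sideSq 1, sideSq (-1)} ∪ residualSq '' S,
    min (min d 1) (min (a / 2) (b / 2)), ?_, by positivity, ?_, ?_⟩
  · exact (Set.toFinite _).union (hSfin.image _)
  · rintro _ ((rfl | rfl | rfl) | ⟨s, -, rfl⟩)
    · exact ⟨hfm, hfLp⟩
    · exact ⟨measurable_sideSq _, memLp_sideSq _⟩
    · exact ⟨measurable_sideSq _, memLp_sideSq _⟩
    · exact ⟨measurable_residualSq s, memLp_residualSq s⟩
  intro n hn V g hF
  have hn0 : (0 : ℝ) < n := Nat.cast_pos.2 hn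
  set ε := min (min d 1) (min (a / 2) (b / 2)) with hε
  have hεd : ε * n ≤ d * n :=
    mul_le_mul_of_nonneg_right ((min_le_left _ _).trans (min_le_left _ _)) hn0.le
  have hε1 : ε * n ≤ 1 * n :=
    mul_le_mul_of_nonneg_right ((min_le_left _ _).trans (min_le_right _ _)) hn0.le
  have hεa : ε * n ≤ a / 2 * n :=
    mul_le_mul_of_nonneg_right ((min_le_right _ _).trans (min_le_left _ _)) hn0.le
  have hεb : ε * n ≤ b / 2 * n :=
    mul_le_mul_of_nonneg_right ((min_le_right _ _).trans (min_le_right _ _)) hn0.le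
  have hFf := abs_lt.1 (hF f (by simp))
  have hFa := abs_lt.1 (hF (sideSq 1) (by simp))
  have hFb := abs_lt.1 (hF (sideSq (-1)) (by simp))
  rw [← hm] at hFf
  rw [← ha] at hFa
  rw [← hb] at hFb
  have hsa : a / 2 * n < ∑ i, sideSq 1 (V i, g i) := by linarith
  have hsb : b / 2 * n < ∑ i, sideSq (-1) (V i, g i) := by linarith
  have hside : ∀ {σ t c : ℝ}, M ≤ -(σ * t) → σ ^ 2 = 1 → K < M ^ 2 * (c / 2) →
      c / 2 * n < ∑ i, sideSq σ (V i, g i) → K * n < ∑ i, max (g i - t * V i) 0 ^ 2 := by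
    intro σ t c ht hσ hc hs
    calc K * n < M ^ 2 * (c / 2) * n := mul_lt_mul_of_pos_right hc hn0
      _ = M ^ 2 * (c / 2 * n) := by ring
      _ ≤ M ^ 2 * ∑ i, sideSq σ (V i, g i) := mul_le_mul_of_nonneg_left hs.le (by positivity)
      _ = ∑ i, M ^ 2 * sideSq σ (V i, g i) := Finset.mul_sum _ _ _
      _ ≤ _ := Finset.sum_le_sum fun i _ =>
        sq_mul_sideSq_le (by linarith) ht hσ (V i, g i)
  refine ⟨?_, ?_, fun t => ?_⟩
  · obtain ⟨i, hi⟩ := exists_pos_of_sum_sideSq_pos ((by positivity : 0 < b / 2 * n).trans hsb)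
    exact ⟨i, by linarith⟩
  · obtain ⟨i, hi⟩ := exists_pos_of_sum_sideSq_pos ((by positivity : 0 < a / 2 * n).trans hsa)
    exact ⟨i, by linarith⟩
  rcases le_total M t with h1 | h1
  · exact hside (σ := -1) (by linarith) (by norm_num) hMb hsb
  rcases le_total t (-M) with h2 | h2
  · exact hside (σ := 1) (by linarith) (by norm_num) hMa hsa
  obtain ⟨s, hs, hts⟩ := Set.mem_iUnion₂.1 (hS ⟨h2, h1⟩)
  rw [Metric.mem_ball, Real.dist_eq] at hts
  have hFs := abs_lt.1 (hF (residualSq s) (Or.inr ⟨s, hs, rfl⟩))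
  have hG := mul_le_mul_of_nonneg_right (gMLEinv_le_integral_residualSq γ s) hn0.le
  have hsum : ∑ i, residualSq s (V i, g i) ≤
      ∑ i, max (g i - t * V i) 0 ^ 2 + η * ∑ i, f (V i, g i) := by
    rw [Finset.mul_sum, ← Finset.sum_add_distrib]
    exact Finset.sum_le_sum fun i _ => residualSq_le hts.le hη1 (abs_le.2 ⟨h2, h1⟩) (V i, g i)
  have hfs : η * ∑ i, f (V i, g i) ≤ d / 2 * n := by
    have : ∑ i, f (V i, g i) ≤ (m + 1) * n := by linarith
    calc _ ≤ η * ((m + 1) * n) := mul_le_mul_of_nonneg_left this hη.le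
      _ = η * (m + 1) * n := by ring
      _ ≤ _ := mul_le_mul_of_nonneg_right hηd hn0.le
  rw [← hdK] at hG
  nlinarith [mul_pos hd hn0]

end UniformLowerBound

section Existence

lemma tendsto_gauss_tail : Tendsto (fun c : ℝ => gauss {x | c ≤ x}) atTop (𝓝 0) := by
  have h : ⋂ c : ℝ, Set.Ici c = ∅ :=
    Set.eq_empty_of_forall_notMem fun x hx => by
      have := Set.mem_Ici.1 (Set.mem_iInter.1 hx (x + 1))
      linarith
  rw [← measure_empty (μ := gauss), ← h]
  exact tendsto_measure_iInter_atTop (fun c => measurableSet_Ici.nullMeasurableSet)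
    (fun _ _ hab => Set.Ici_subset_Ici.2 hab) ⟨0, measure_ne_top _ _⟩

lemma integral_sq_gauss : ∫ x, x ^ 2 ∂gauss = 1 := by
  have h := variance_of_integral_eq_zero (μ := gauss) (X := fun x : ℝ => x) (by fun_prop)
    (by unfold gauss; exact integral_id_gaussianReal)
  rw [← h]
  unfold gauss
  simp

lemma tendsto_gaussPi_sq_norm {k : ℕ → ℕ} (hk : Tendsto k atTop atTop) {q : ℝ} (hq : 1 < q) :
    Tendsto (fun n => gaussPi (Fin (k n)) {h | q * k n ≤ ∑ l, h l ^ 2}) atTop (𝓝 0) := by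
  have h := tendsto_measure_deviation (fun _ => gauss) (f := fun x : ℝ => x ^ 2)
    (C := ∫ x : ℝ, (x ^ 2) ^ 2 ∂gauss) (fun _ => memLp_sq_gauss) (fun _ => le_rfl)
    tendsto_const_nhds hk (sub_pos.2 hq)
  refine tendsto_of_tendsto_of_tendsto_of_le_of_le tendsto_const_nhds h (fun _ => zero_le)
    fun n => measure_mono fun x hx => ?_
  rw [Set.mem_ofPred_eq] at hx ⊢
  rw [integral_sq_gauss]
  refine le_trans ?_ (le_abs_self _)
  linarith

lemma exists_unit_direction {n p : ℕ} (hn : 0 < n) (hp : 0 < p) (β : Fin p → ℝ) :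
    ∃ e : Fin p → ℝ, ∑ j, e j ^ 2 = 1 ∧
      ∀ j, β j = Real.sqrt n * Real.sqrt ((∑ j, β j ^ 2) / n) * e j := by
  have hn0 : (0 : ℝ) < n := Nat.cast_pos.2 hn
  have hS : 0 ≤ ∑ j, β j ^ 2 := Finset.sum_nonneg fun j _ => sq_nonneg _
  have hmul : Real.sqrt n * Real.sqrt ((∑ j, β j ^ 2) / n) = Real.sqrt (∑ j, β j ^ 2) := by
    rw [← Real.sqrt_mul hn0.le, mul_div_cancel₀ _ hn0.ne']
  rw [hmul]
  rcases hS.eq_or_lt with h0 | h0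
  · refine ⟨Pi.single ⟨0, hp⟩ 1, ?_, fun j => ?_⟩
    · simp [Pi.single_apply, ite_pow]
    · have := (Finset.sum_eq_zero_iff_of_nonneg fun j _ => sq_nonneg (β j)).1 h0.symm j
        (Finset.mem_univ j)
      rw [← h0, Real.sqrt_zero, zero_mul]
      exact pow_eq_zero_iff two_ne_zero |>.1 this
  · refine ⟨fun j => β j / Real.sqrt (∑ j, β j ^ 2), ?_, fun j => ?_⟩
    · simp only [div_pow, Real.sq_sqrt hS]
      rw [← Finset.sum_div, div_self h0.ne']
    · rw [mul_div_cancel₀ _ (Real.sqrt_pos.2 h0).ne']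

lemma measurePreserving_zip (n : ℕ) (γ : ℝ) :
    MeasurePreserving (fun (z : (Fin n → ℝ) × (Fin n → ℝ)) i => (z.1 i, z.2 i))
      ((Measure.pi fun _ : Fin n => tiltedGauss γ).prod (gaussPi (Fin n)))
      (Measure.pi fun _ : Fin n => pairLaw γ) :=
  (measurePreserving_arrowProdEquivProdArrow ℝ ℝ (Fin n) (fun _ => tiltedGauss γ)
    (fun _ => gauss)).symm

/-- The probability that the data are (weakly) separated tends to zero. -/
theorem tendsto_designLaw_separated {κ γ : ℝ} (hκ : 0 < κ) (hγ : 0 ≤ γ) (hsig : κ < gMLEinv γ)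
    {p : ℕ → ℕ} (hp : Tendsto (fun n => (p n : ℝ) / n) atTop (𝓝 κ))
    (β : (n : ℕ) → Fin (p n) → ℝ)
    (hβ : Tendsto (fun n => (∑ j, (β n j) ^ 2) / n) atTop (𝓝 (γ ^ 2))) :
    Tendsto (fun n => designLaw n (p n) {Z | ∃ b : Fin (p n) → ℝ, b ≠ 0 ∧
      ∀ i, 0 ≤ (2 * resp Z.1 Z.2 (β n) i - 1) * ∑ j, Z.1 i j * b j}) atTop (𝓝 0) := by
  obtain ⟨K, hκK, hK⟩ := exists_between hsig
  obtain ⟨L, hκL, hLK⟩ := exists_between hκK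
  obtain ⟨l, hκl, hlL⟩ := exists_between hκL
  have hl0 : 0 < l := hκ.trans hκl
  have hL0 : 0 < L := hl0.trans hlL
  obtain ⟨F, ε, hFfin, hε, hF, hdet⟩ := exists_finite_test_functions hK
  let g : ℕ → ℝ := fun n => Real.sqrt ((∑ j, (β n j) ^ 2) / n)
  have hg : Tendsto g atTop (𝓝 γ) := by
    have := (Real.continuous_sqrt.tendsto _).comp hβ
    rwa [Real.sqrt_sq hγ] at this
  let a := (Real.sqrt K - Real.sqrt L) / 2
  have ha : 0 < a := half_pos (sub_pos.2 (Real.sqrt_lt_sqrt hL0.le hLK))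
  have hsqrt : Tendsto (fun n : ℕ => Real.sqrt n) atTop atTop :=
    Real.tendsto_sqrt_atTop.comp tendsto_natCast_atTop_atTop
  have hpinf : Tendsto p atTop atTop := by
    have h1 := hp.pos_mul_atTop hκ (tendsto_natCast_atTop_atTop (R := ℝ))
    refine tendsto_natCast_atTop_iff.1 (h1.congr' ?_)
    filter_upwards [eventually_gt_atTop 0] with n hn
    exact div_mul_cancel₀ _ (Nat.cast_pos.2 hn).ne'
  let D : (n : ℕ) → Set (Fin n → ℝ × ℝ) := fun n =>
    ⋃ f ∈ F, {x | ε * n ≤ |∑ i, f (x i) - (∫ z, f z ∂pairLaw γ) * n|}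
  have hD : ∀ n, MeasurableSet (D n) := fun n => by
    refine hFfin.measurableSet_biUnion fun f hf => measurableSet_le measurable_const ?_
    exact ((Finset.measurable_sum _ fun i _ =>
      (hF f hf).1.comp (measurable_pi_apply i)).sub_const _).abs
  have hlim : Tendsto (fun n : ℕ => gauss {x | a * Real.sqrt n ≤ x} +
      gaussPi (Fin (p n)) {h | L / l * p n ≤ ∑ j, h j ^ 2} +
      (Measure.pi fun _ : Fin n => pairLaw (g n)) (D n)) atTop (𝓝 0) := by
    simpa using ((tendsto_gauss_tail.comp (hsqrt.const_mul_atTop ha)).add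
      (tendsto_gaussPi_sq_norm hpinf ((one_lt_div hl0).2 hlL))).add
        (tendsto_measure_exists_deviation hFfin (fun f hf => (hF f hf).2) hg hε)
  refine tendsto_of_tendsto_of_tendsto_of_le_of_le' tendsto_const_nhds hlim
    (.of_forall fun _ => zero_le) ?_
  filter_upwards [eventually_gt_atTop 0, hpinf.eventually_gt_atTop 0, hp.eventually_lt_const hκl]
    with n hn hpn hpl
  have hn0 : (0 : ℝ) < n := Nat.cast_pos.2 hn
  obtain ⟨e, he, hβe⟩ := exists_unit_direction hn hpn (β n)
  have hsn : 0 < Real.sqrt n := Real.sqrt_pos.2 hn0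
  refine (designLaw_separated_le hn he hβe (c := a * Real.sqrt n)
    (r := Real.sqrt L * Real.sqrt n) (mul_pos ha hsn) (by positivity)
    ((measurePreserving_zip n (g n)).measurable (hD n)) fun V h hVh => ?_).trans ?_
  · have hVh' : ∀ f ∈ F, |∑ i, f (V i, h i) - (∫ z, f z ∂pairLaw γ) * n| < ε * n := by
      simpa [D] using hVh
    obtain ⟨hneg, hpos, hmain⟩ := hdet n hn V h hVh'
    refine exists_mem_conicSphere_lt h V hneg hpos fun t => ?_
    have hR : Real.sqrt L * Real.sqrt n + 2 * (a * Real.sqrt n) =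
        Real.sqrt K * Real.sqrt n := by simp only [a]; ring
    rw [hR, mul_pow, Real.sq_sqrt (hL0.trans hLK).le, Real.sq_sqrt hn0.le]
    exact hmain t
  · rw [(measurePreserving_zip n (g n)).measure_preimage (hD n).nullMeasurableSet]
    gcongr
    rw [mul_pow, Real.sq_sqrt hL0.le, Real.sq_sqrt hn0.le]
    rw [div_lt_iff₀ hn0] at hpl
    calc L / l * p n ≤ L / l * (l * n) := by gcongr
      _ = L * n := by field_simp

end Existence

/-- If `γ < g_MLE(κ)` (equivalently `κ < g_MLE⁻¹(γ)`), then in the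
high-dimensional logistic model with `p/n → κ`, i.i.d. `N(0, n⁻¹ I_p)` rows and
`‖β‖²/n → γ²`, the probability that the MLE exists tends to `1`. -/
theorem mle_asymptotically_exists
    (κ γ : ℝ) (hκ : κ ∈ Set.Ioo (0 : ℝ) 1) (hγ : 0 ≤ γ)
    (hsig : κ < gMLEinv γ)
    (p : ℕ → ℕ) (hp : Tendsto (fun n => (p n : ℝ) / n) atTop (𝓝 κ))
    {Ω : Type*} [MeasurableSpace Ω] (μ : Measure Ω) [IsProbabilityMeasure μ]
    (X : (n : ℕ) → Ω → Fin n → Fin (p n) → ℝ) (U : (n : ℕ) → Ω → Fin n → ℝ)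
    (hmeas : ∀ n, Measurable (fun ω => (X n ω, U n ω)))
    (hlaw : ∀ n, Measure.map (fun ω => (X n ω, U n ω)) μ = designLaw n (p n))
    (β : (n : ℕ) → Fin (p n) → ℝ)
    (hβ : Tendsto (fun n => (∑ j, (β n j) ^ 2) / n) atTop (𝓝 (γ ^ 2))) :
    Tendsto
      (fun n => μ {ω | ∃ b : Fin (p n) → ℝ, ∀ b' : Fin (p n) → ℝ,
        negLogLik (X n ω) (resp (X n ω) (U n ω) (β n)) b ≤
          negLogLik (X n ω) (resp (X n ω) (U n ω) (β n)) b'})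
      atTop (𝓝 1) := by
  let S : (n : ℕ) → Set ((Fin n → Fin (p n) → ℝ) × (Fin n → ℝ)) := fun n =>
    {Z | ∃ b : Fin (p n) → ℝ, b ≠ 0 ∧
      ∀ i, 0 ≤ (2 * resp Z.1 Z.2 (β n) i - 1) * ∑ j, Z.1 i j * b j}
  have hS : Tendsto (fun n => designLaw n (p n) (S n)) atTop (𝓝 0) :=
    tendsto_designLaw_separated hκ.1 hγ hsig hp β hβ
  have hlow : Tendsto (fun n => 1 - designLaw n (p n) (S n)) atTop (𝓝 1) := by
    simpa using ENNReal.Tendsto.sub tendsto_const_nhds hS (Or.inl ENNReal.one_ne_top)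
  refine tendsto_of_tendsto_of_tendsto_of_le_of_le hlow tendsto_const_nhds (fun n => ?_)
    fun n => prob_le_one
  rw [tsub_le_iff_right, ← hlaw n, ← measure_univ (μ := μ)]
  refine le_trans (measure_mono fun ω _ => ?_) ((measure_union_le _ _).trans
    (add_le_add_right (Measure.le_map_apply (hmeas n).aemeasurable (S n)) _))
  by_cases hω : (X n ω, U n ω) ∈ S n
  · exact Or.inr hω
  · refine Or.inl (exists_min_negLogLik _ _ (fun i => ?_) fun b hb => ?_)
    · unfold resp
      split_ifs <;> simp
    · by_contra! hcon
      exact hω ⟨b, hb, hcon⟩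
end
end

section
/- Suppose the data (X_i, y_i), i = 1,…,n, with X_i ∈ ℝᵖ and y_i ∈ {0,1}, are completely separated: there exists b ∈ ℝᵖ such that (2y_i − 1)⟨X_i, b⟩ > 0 for every i. Then the logistic negative log-likelihood ℓ(b') = Σ_{i=1}^n {ρ(⟨X_i, b'⟩) − y_i ⟨X_i, b'⟩} has infimum 0 over ℝᵖ (attained only in the limit, since ℓ(tb) → 0 as t → ∞ while ℓ(b') > 0 for every b' ∈ ℝᵖ), and hence the maximum-likelihood estimator does not exist. -/
open MeasureTheory ProbabilityTheory Filter
open scoped Topology NNReal ENNReal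

noncomputable section

theorem rho_pos (t : ℝ) : 0 < rho t :=
  Real.log_pos (by linarith [Real.exp_pos t])

theorem rho_sub_self (t : ℝ) : rho t - t = rho (-t) := by
  have h : 1 + Real.exp t = Real.exp t * (1 + Real.exp (-t)) := by
    rw [mul_add, ← Real.exp_add]
    simp [add_comm]
  rw [rho, rho, h, Real.log_mul (Real.exp_ne_zero _) (by positivity), Real.log_exp]
  ring

theorem tendsto_rho_atBot : Tendsto rho atBot (𝓝 0) := by
  have h : Tendsto (fun t : ℝ => 1 + Real.exp t) atBot (𝓝 1) := by
    simpa using Real.tendsto_exp_atBot.const_add 1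
  rw [← Real.log_one]
  exact h.log one_ne_zero

/-- A logistic loss term depends only on the signed margin `(2y - 1)s`. -/
theorem rho_sub_label_mul {y : ℝ} (hy : y = 0 ∨ y = 1) (s : ℝ) :
    rho s - y * s = rho (-((2 * y - 1) * s)) := by
  rcases hy with rfl | rfl
  · norm_num
  · norm_num [rho_sub_self]

theorem negLogLik_eq_sum_rho_margin {n p : ℕ} (X : Fin n → Fin p → ℝ) {y : Fin n → ℝ}
    (hy : ∀ i, y i = 0 ∨ y i = 1) (b : Fin p → ℝ) :
    negLogLik X y b = ∑ i, rho (-((2 * y i - 1) * ∑ j, X i j * b j)) :=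
  Finset.sum_congr rfl fun i _ => rho_sub_label_mul (hy i) _

theorem negLogLik_pos {n p : ℕ} (hn : 0 < n) (X : Fin n → Fin p → ℝ) {y : Fin n → ℝ}
    (hy : ∀ i, y i = 0 ∨ y i = 1) (b : Fin p → ℝ) : 0 < negLogLik X y b := by
  rw [negLogLik_eq_sum_rho_margin X hy]
  exact Finset.sum_pos (fun i _ => rho_pos _) ⟨⟨0, hn⟩, Finset.mem_univ _⟩

theorem tendsto_negLogLik_ray {n p : ℕ} (X : Fin n → Fin p → ℝ) {y : Fin n → ℝ}
    (hy : ∀ i, y i = 0 ∨ y i = 1) {b : Fin p → ℝ}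
    (hsep : ∀ i, 0 < (2 * y i - 1) * ∑ j, X i j * b j) :
    Tendsto (fun t : ℝ => negLogLik X y (fun j => t * b j)) atTop (𝓝 0) := by
  simp_rw [negLogLik_eq_sum_rho_margin X hy, mul_left_comm _ _ (b _), ← Finset.mul_sum,
    mul_left_comm (2 * y _ - 1)]
  rw [← Finset.sum_const_zero (M := ℝ) (s := (Finset.univ : Finset (Fin n)))]
  exact tendsto_finsetSum _ fun i _ => tendsto_rho_atBot.comp
    (tendsto_neg_atTop_atBot.comp (tendsto_id.atTop_mul_const (hsep i)))

/-- Under complete separation (some direction `b` with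
`(2y_i - 1)⟨X_i, b⟩ > 0` for all `i`), the logistic negative log-likelihood is
everywhere positive, tends to `0` along the ray `t b` as `t → ∞`, has infimum `0`, and
hence does not attain its minimum: the MLE does not exist. -/
theorem separation_implies_no_mle (n p : ℕ) (hn : 0 < n)
    (X : Fin n → Fin p → ℝ) (y : Fin n → ℝ) (hy : ∀ i, y i = 0 ∨ y i = 1)
    (b : Fin p → ℝ) (hsep : ∀ i, 0 < (2 * y i - 1) * ∑ j, X i j * b j) :
    (∀ b' : Fin p → ℝ, 0 < negLogLik X y b') ∧
    Tendsto (fun t : ℝ => negLogLik X y (fun j => t * b j)) atTop (𝓝 0) ∧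
    (⨅ b' : Fin p → ℝ, negLogLik X y b') = 0 ∧
    ¬∃ b' : Fin p → ℝ, ∀ b'' : Fin p → ℝ, negLogLik X y b' ≤ negLogLik X y b'' := by
  have hpos := negLogLik_pos hn X hy
  have hlim := tendsto_negLogLik_ray X hy hsep
  refine ⟨hpos, hlim, ?_, ?_⟩
  · refine le_antisymm (ge_of_tendsto' hlim fun t => ?_) (le_ciInf fun b' => (hpos b').le)
    exact ciInf_le ⟨0, Set.forall_mem_range.2 fun b' => (hpos b').le⟩ _
  · rintro ⟨b', hb'⟩
    exact (hpos b').not_ge (ge_of_tendsto' hlim fun t => hb' _)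
end
end
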